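/- Let Ω ⊆ ℂ be a Denjoy domain with Ω ∩ ℝ = ⋃_{n=1}^N (a_n, b_n) a finite union of intervals (not necessarily in order on the line), and let κ_Ω denote either the Poincaré metric h_Ω or the quasihyperbolic metric k_Ω. Then κ_Ω is Gromov δ-hyperbolic, where δ is a constant depending only on N and on c₀ = sup_n κ_Ω((a_n, b_n), (a_{n+1}, b_{n+1})), the supremum of the κ_Ω-distances between consecutive (in index) components of Ω ∩ ℝ. -/

import Mathlib

open Set Metric Filter Complex

noncomputable section

/-- The length of a curve `γ : [0,1] → E` with respect to the conformal density `ρ`. -/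
def curveLen {E : Type*} [NormedAddCommGroup E] [NormedSpace ℝ E]
    (ρ : E → ℝ) (γ : ℝ → E) : ℝ :=
  ∫ t in (0:ℝ)..1, ρ (γ t) * ‖deriv γ t‖

/-- The distance induced on the set `S` by the conformal density `ρ`, defined as the infimum
of the `ρ`-lengths of C¹ curves joining the two points inside `S`. -/
def densityDist {E : Type*} [NormedAddCommGroup E] [NormedSpace ℝ E]
    (S : Set E) (ρ : E → ℝ) (z w : E) : ℝ :=
  sInf { L | ∃ γ : ℝ → E, ContDiffOn ℝ 1 γ (Icc 0 1) ∧ γ 0 = z ∧ γ 1 = w ∧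
      (∀ t ∈ Icc (0:ℝ) 1, γ t ∈ S) ∧ L = curveLen ρ γ }

/-- The quasihyperbolic density `1/δ_Ω(z)` of a domain `Ω`. -/
def qhDensity {E : Type*} [NormedAddCommGroup E] [NormedSpace ℝ E] (Ω : Set E) : E → ℝ :=
  fun z => (Metric.infDist z Ωᶜ)⁻¹

/-- The quasihyperbolic distance of a domain `Ω`. -/
def qhDist {E : Type*} [NormedAddCommGroup E] [NormedSpace ℝ E] (Ω : Set E) : E → E → ℝ :=
  densityDist Ω (qhDensity Ω)

/-- `lam` is the density of the Poincaré (hyperbolic) metric of the plane domain `Ω`: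
it is the pushforward of the density `2/(1-|z|²)` of the unit disk under a holomorphic
universal covering map `p : 𝔻 → Ω`. -/
def IsPoincareDensity (Ω : Set ℂ) (lam : ℂ → ℝ) : Prop :=
  ∃ p : ℂ → ℂ,
    (∀ z ∈ ball (0:ℂ) 1, DifferentiableAt ℂ p z) ∧
    p '' ball (0:ℂ) 1 = Ω ∧
    IsCoveringMapOn (fun z : ball (0:ℂ) 1 => p z) Ω ∧
    ∀ z ∈ ball (0:ℂ) 1, lam (p z) * ‖deriv p z‖ = 2 / (1 - ‖z‖ ^ 2)

/-- `g` is a geodesic in `(S, d)` from `x` to `y`, parametrized by arclength on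
`[0, d x y]`. -/
def IsGeodesicIn {α : Type*} (S : Set α) (d : α → α → ℝ) (g : ℝ → α) (x y : α) : Prop :=
  g 0 = x ∧ g (d x y) = y ∧ (∀ t ∈ Icc (0:ℝ) (d x y), g t ∈ S) ∧
  ∀ s ∈ Icc (0:ℝ) (d x y), ∀ t ∈ Icc (0:ℝ) (d x y), d (g s) (g t) = |s - t|

/-- Every geodesic triangle of `(S, d)` is `δ`-thin (Rips condition). -/
def GromovHyperbolicWith {α : Type*} (S : Set α) (d : α → α → ℝ) (δ : ℝ) : Prop :=
  ∀ x ∈ S, ∀ y ∈ S, ∀ z ∈ S, ∀ gxy gxz gzy : ℝ → α,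
    IsGeodesicIn S d gxy x y → IsGeodesicIn S d gxz x z → IsGeodesicIn S d gzy z y →
    ∀ t ∈ Icc (0:ℝ) (d x y),
      ∃ p ∈ gxz '' Icc (0:ℝ) (d x z) ∪ gzy '' Icc (0:ℝ) (d z y), d (gxy t) p ≤ δ

/-- `(S, d)` is Gromov hyperbolic: some `δ ≥ 0` works for all geodesic triangles. -/
def IsGromovHyperbolic {α : Type*} (S : Set α) (d : α → α → ℝ) : Prop :=
  ∃ δ : ℝ, 0 ≤ δ ∧ GromovHyperbolicWith S d δ

/-- The real axis inside `ℂ`. -/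
def realLine : Set ℂ := {z : ℂ | z.im = 0}

/-- A Denjoy domain: a domain whose boundary is contained in the real axis. -/
def IsDenjoyDomain (Ω : Set ℂ) : Prop :=
  IsOpen Ω ∧ IsConnected Ω ∧ frontier Ω ⊆ realLine

/-- The distance (for the distance function `d`) from a point to a set. -/
def distToSet {α : Type*} (d : α → α → ℝ) (z : α) (A : Set α) : ℝ :=
  sInf (d z '' A)

/-- A fundamental geodesic: a geodesic of `(S, d)` contained in the closed upper half plane,
joining a point of the boundary interval `I` (on the real axis) to a point of the boundary
interval `J`. -/
def IsFundGeodesic (S : Set ℂ) (d : ℂ → ℂ → ℝ) (I J : Set ℝ) (g : ℝ → ℂ) (x y : ℂ) : Prop :=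
  IsGeodesicIn S d g x y ∧ x.im = 0 ∧ x.re ∈ I ∧ y.im = 0 ∧ y.re ∈ J ∧
  ∀ t ∈ Icc (0:ℝ) (d x y), 0 ≤ (g t).im

end

noncomputable section

/-- The distance between two sets for a distance function `d`. -/
def setDistFor {α : Type*} (d : α → α → ℝ) (A B : Set α) : ℝ :=
  sInf {r : ℝ | ∃ x ∈ A, ∃ y ∈ B, r = d x y}

/-- `d` is a pseudometric on the set `S`. -/
structure IsPseudoDistOn {α : Type*} (S : Set α) (d : α → α → ℝ) : Prop where
  nonneg : ∀ x ∈ S, ∀ y ∈ S, 0 ≤ d x y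
  self : ∀ x ∈ S, d x x = 0
  symm : ∀ x ∈ S, ∀ y ∈ S, d x y = d y x
  triangle : ∀ x ∈ S, ∀ y ∈ S, ∀ z ∈ S, d x z ≤ d x y + d y z

/-- Gromov's four point condition for `d` on the set `S`. -/
def FourPointOn {α : Type*} (S : Set α) (d : α → α → ℝ) (δ : ℝ) : Prop :=
  ∀ x ∈ S, ∀ y ∈ S, ∀ z ∈ S, ∀ w ∈ S,
    d x y + d z w ≤ max (d x z + d y w) (d x w + d y z) + δ

/-- Every point `x` of `S` has a coarse projection to `A`: a point through which all geodesics
from `x` to `A` pass, up to an additive error. -/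
def HasCoarseProj {α : Type*} (S : Set α) (d : α → α → ℝ) (A : Set α) (C : ℝ) : Prop :=
  ∀ x ∈ S, ∃ p ∈ A, ∀ a ∈ A, d x p + d p a ≤ d x a + C

theorem IsPseudoDistOn.mono {α : Type*} {S T : Set α} {d : α → α → ℝ} (h : IsPseudoDistOn S d)
    (hT : T ⊆ S) : IsPseudoDistOn T d where
  nonneg x hx y hy := h.nonneg x (hT hx) y (hT hy)
  self x hx := h.self x (hT hx)
  symm x hx y hy := h.symm x (hT hx) y (hT hy)
  triangle x hx y hy z hz := h.triangle x (hT hx) y (hT hy) z (hT hz)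

theorem FourPointOn.nonneg {α : Type*} {S : Set α} {d : α → α → ℝ} {δ : ℝ}
    (h : FourPointOn S d δ) (hd : IsPseudoDistOn S d) (hS : S.Nonempty) : 0 ≤ δ := by
  obtain ⟨x, hx⟩ := hS
  have := h x hx x hx x hx x hx
  simp only [hd.self x hx, max_self] at this
  linarith

theorem FourPointOn.mono {α : Type*} {S : Set α} {d : α → α → ℝ} {δ δ' : ℝ}
    (h : FourPointOn S d δ) (hδ : δ ≤ δ') : FourPointOn S d δ' :=
  fun x hx y hy z hz w hw => (h x hx y hy z hz w hw).trans (by linarith)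

/-- The four point condition implies that geodesic triangles are thin. -/
theorem FourPointOn.gromovHyperbolicWith {α : Type*} {S : Set α} {d : α → α → ℝ} {δ : ℝ}
    (h : FourPointOn S d δ) (hd : IsPseudoDistOn S d) : GromovHyperbolicWith S d (2 * δ) := by
  intro x hx y hy z hz gxy gxz gzy hxy hxz hzy t ht
  have hδ : 0 ≤ δ := h.nonneg hd ⟨x, hx⟩
  obtain ⟨a0, a1, aS, aD⟩ := hxy
  obtain ⟨b0, b1, bS, bD⟩ := hxz
  obtain ⟨c0, c1, cS, cD⟩ := hzy
  set w := gxy t with hw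
  have hwS : w ∈ S := aS t ht
  have dxy := hd.nonneg x hx y hy
  have dxz := hd.nonneg x hx z hz
  have dzy := hd.nonneg z hz y hy
  have hxw : d x w = t := by
    have := aD 0 ⟨le_rfl, dxy⟩ t ht
    rw [a0, zero_sub, abs_neg, abs_of_nonneg ht.1] at this
    exact this
  have hyw : d y w = d x y - t := by
    have := aD (d x y) ⟨dxy, le_rfl⟩ t ht
    rw [a1, abs_of_nonneg (by linarith [ht.2])] at this
    exact this
  have h1 := h x hx y hy z hz w hwS
  rw [hxw, hyw] at h1
  have hzw0 := hd.nonneg z hz w hwS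
  rcases le_total (d y z) (d x z + (d x y - t) - t) with hc | hc
  · rw [max_eq_left (by linarith)] at h1
    rcases le_total t (d x z) with htz | htz
    · refine ⟨gxz t, Or.inl ⟨t, ⟨ht.1, htz⟩, rfl⟩, ?_⟩
      set p := gxz t with hp
      have hpS : p ∈ S := bS t ⟨ht.1, htz⟩
      have hxp : d x p = t := by
        have := bD 0 ⟨le_rfl, dxz⟩ t ⟨ht.1, htz⟩
        rw [b0, zero_sub, abs_neg, abs_of_nonneg ht.1] at this
        exact this
      have hpz : d p z = d x z - t := by
        have := bD t ⟨ht.1, htz⟩ (d x z) ⟨dxz, le_rfl⟩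
        rw [b1, abs_sub_comm, abs_of_nonneg (by linarith)] at this
        exact this
      have h2 := h w hwS p hpS x hx z hz
      have e1 := hd.symm w hwS x hx
      have e2 := hd.symm w hwS z hz
      have e3 := hd.symm p hpS x hx
      rw [e1, hxw, hpz, e2, e3, hxp] at h2
      have : max (t + (d x z - t)) (d z w + t) ≤ d x z + δ := max_le (by linarith) (by linarith)
      linarith
    · refine ⟨z, Or.inl ⟨d x z, ⟨dxz, le_rfl⟩, b1⟩, ?_⟩
      rw [hd.symm w hwS z hz]
      linarith
  · rw [max_eq_right (by linarith)] at h1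
    rcases le_total (d x y - t) (d z y) with htz | htz
    · have hs : d z y - (d x y - t) ∈ Icc (0:ℝ) (d z y) := ⟨by linarith, by linarith [ht.2]⟩
      refine ⟨gzy (d z y - (d x y - t)), Or.inr ⟨_, hs, rfl⟩, ?_⟩
      set p := gzy (d z y - (d x y - t)) with hp
      have hpS : p ∈ S := cS _ hs
      have hpy : d p y = d x y - t := by
        have := cD _ hs (d z y) ⟨dzy, le_rfl⟩
        rw [c1, abs_sub_comm, abs_of_nonneg (by linarith [ht.2])] at this
        linarith
      have hzp : d p z = d z y - (d x y - t) := by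
        have := cD _ hs 0 ⟨le_rfl, dzy⟩
        rw [c0, sub_zero, abs_of_nonneg hs.1] at this
        exact this
      have h2 := h w hwS p hpS y hy z hz
      have e1 := hd.symm w hwS y hy
      have e2 := hd.symm w hwS z hz
      have e3 := hd.symm y hy z hz
      rw [e1, hyw, hzp, e2, hpy, e3] at h2
      have : max (d x y - t + (d z y - (d x y - t))) (d z w + (d x y - t)) ≤ d z y + δ :=
        max_le (by linarith) (by linarith)
      linarith
    · refine ⟨z, Or.inr ⟨0, ⟨le_rfl, dzy⟩, c0⟩, ?_⟩
      rw [hd.symm w hwS z hz]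
      have := hd.symm y hy z hz
      linarith

/-- A symmetric function satisfying the coarse ultrametric inequality gives rise to the
four point condition. -/
theorem add_le_add_of_min_le {α : Type*} {S : Set α} {g : α → α → ℝ} {C : ℝ}
    (hg : ∀ x ∈ S, ∀ y ∈ S, ∀ z ∈ S, min (g x z) (g z y) ≤ g x y + C)
    (hs : ∀ x ∈ S, ∀ y ∈ S, g x y = g y x) {x y z w : α} (hx : x ∈ S) (hy : y ∈ S) (hz : z ∈ S)
    (hw : w ∈ S) :
    min (g x z + g y w) (g x w + g y z) ≤ g x y + g z w + 2 * C := by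
  have a1 := hg x hx y hy z hz
  have a2 := hg x hx y hy w hw
  have a3 := hg z hz w hw x hx
  have a4 := hg z hz w hw y hy
  rw [hs z hz y hy] at a1
  rw [hs w hw y hy] at a2
  rw [hs z hz x hx] at a3
  rw [hs z hz y hy] at a4
  simp only [min_le_iff] at *
  grind

/-- If two sets with coarse projections are at bounded distance then their union has coarse
projections. -/
theorem HasCoarseProj.union {α : Type*} {S : Set α} {d : α → α → ℝ} {δ C c : ℝ} {A B : Set α}
    (h : FourPointOn S d δ) (hd : IsPseudoDistOn S d) (hAS : A ⊆ S) (hBS : B ⊆ S)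
    (hA : HasCoarseProj S d A C) (hB : HasCoarseProj S d B C) (hc : 0 ≤ c) (hC : 0 ≤ C)
    (hAB : ∃ a ∈ A, ∃ b ∈ B, d a b ≤ c) :
    HasCoarseProj S d (A ∪ B) (3 * C + 2 * c + 3 * δ) := by
  intro x hx
  have hδ : 0 ≤ δ := h.nonneg hd ⟨x, hx⟩
  obtain ⟨a₀, ha₀, b₀, hb₀, hab⟩ := hAB
  have key : ∀ {A B : Set α}, A ⊆ S → B ⊆ S → ∀ {a₀ b₀ p q}, a₀ ∈ A → b₀ ∈ B → d a₀ b₀ ≤ c →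
      p ∈ A → q ∈ B → (∀ a ∈ A, d x p + d p a ≤ d x a + C) →
      (∀ a ∈ B, d x q + d q a ≤ d x a + C) → d x p ≤ d x q →
      ∀ b ∈ B, d x p + d p b ≤ d x b + (3 * C + 2 * c + 3 * δ) := by
    intro A B hA hB a₀ b₀ p q ha₀ hb₀ hab hp hq h1 h2 hpq b hb
    have i1 := h1 a₀ ha₀
    have i2 := h2 b₀ hb₀
    have i3 := h2 b hb
    have f1 := h x hx a₀ (hA ha₀) p (hA hp) b (hB hb)
    have f2 := h x hx b₀ (hB hb₀) q (hB hq) b (hB hb)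
    have t1 := hd.triangle x hx b₀ (hB hb₀) a₀ (hA ha₀)
    have t2 := hd.triangle a₀ (hA ha₀) b₀ (hB hb₀) b (hB hb)
    have t3 := hd.triangle x hx a₀ (hA ha₀) b₀ (hB hb₀)
    have s1 := hd.symm a₀ (hA ha₀) b₀ (hB hb₀)
    have s2 := hd.symm p (hA hp) a₀ (hA ha₀)
    have s3 := hd.symm q (hB hq) b₀ (hB hb₀)
    have n1 := hd.nonneg a₀ (hA ha₀) b₀ (hB hb₀)
    have g1 := h x hx b (hB hb) p (hA hp) a₀ (hA ha₀)
    have g2 := h p (hA hp) b (hB hb) x hx a₀ (hA ha₀)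
    have g3 := h b₀ (hB hb₀) b (hB hb) x hx q (hB hq)
    have s4 := hd.symm p (hA hp) x hx
    have s5 := hd.symm b (hB hb) x hx
    have s6 := hd.symm b₀ (hB hb₀) x hx
    have s7 := hd.symm b (hB hb) q (hB hq)
    have s8 := hd.symm b (hB hb) a₀ (hA ha₀)
    have s9 := hd.symm b (hB hb) b₀ (hB hb₀)
    have s10 := hd.symm x hx q (hB hq)
    rcases max_choice (d p x + d b a₀) (d p a₀ + d b x) with e1 | e1 <;>
      rcases max_choice (d b₀ x + d b q) (d b₀ q + d b x) with e2 | e2 <;>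
      rw [e1] at g2 <;> rw [e2] at g3 <;> linarith
  obtain ⟨p, hp, hp'⟩ := hA x hx
  obtain ⟨q, hq, hq'⟩ := hB x hx
  rcases le_total (d x p) (d x q) with hpq | hpq
  · refine ⟨p, Or.inl hp, ?_⟩
    rintro a (ha | ha)
    · linarith [hp' a ha]
    · exact key hAS hBS ha₀ hb₀ hab hp hq hp' hq' hpq a ha
  · refine ⟨q, Or.inr hq, ?_⟩
    rintro a (ha | ha)
    · rw [hd.symm a₀ (hAS ha₀) b₀ (hBS hb₀)] at hab
      exact key hBS hAS hb₀ ha₀ hab hq hp hq' hp' hpq a ha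
    · linarith [hq' a ha]

/-- In a space satisfying the four point condition, a coarsely convex set has coarse
projections. -/
theorem HasCoarseProj.of_between {α : Type*} {S : Set α} {d : α → α → ℝ} {δ C : ℝ} {A : Set α}
    (h : FourPointOn S d δ) (hd : IsPseudoDistOn S d) (hAS : A ⊆ S) (hA : A.Nonempty)
    (hC : 0 ≤ C)
    (hmid : ∀ p ∈ A, ∀ a ∈ A, ∀ t ∈ Icc (0 : ℝ) (d p a), ∃ q ∈ A, d p q = t ∧
      d q a ≤ d p a - t + C) :
    HasCoarseProj S d A (2 * (C + δ + 1)) := by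
  intro x hx
  have hbdd : BddBelow (d x '' A) := ⟨0, by
    rintro _ ⟨a, ha, rfl⟩
    exact hd.nonneg x hx a (hAS ha)⟩
  obtain ⟨_, ⟨p, hp, rfl⟩, hpl⟩ :=
    exists_lt_of_csInf_lt (hA.image (d x)) (lt_add_one (sInf (d x '' A)))
  have hmin : ∀ q ∈ A, d x p ≤ d x q + 1 := fun q hq => by
    have := csInf_le hbdd ⟨q, hq, rfl⟩
    linarith
  refine ⟨p, hp, fun a ha => ?_⟩
  have s1 := hd.symm x hx p (hAS hp)
  have s2 := hd.symm x hx a (hAS ha)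
  have s3 := hd.symm p (hAS hp) a (hAS ha)
  have t1 := hd.triangle x hx p (hAS hp) a (hAS ha)
  have t2 := hd.triangle p (hAS hp) a (hAS ha) x hx
  have t3 := hd.triangle p (hAS hp) x hx a (hAS ha)
  obtain ⟨q, hq, hq1, hq2⟩ := hmid p hp a ha ((d p x + d p a - d x a) / 2)
    ⟨by linarith, by linarith⟩
  have f := h x hx q (hAS hq) p (hAS hp) a (hAS ha)
  have s4 := hd.symm p (hAS hp) q (hAS hq)
  have := hmin q hq
  rcases max_choice (d x p + d q a) (d x a + d q p) with e | e <;> rw [e] at f <;> linarith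

/-- The double of a space satisfying the four point condition along a subset with coarse
projections satisfies the four point condition. Here `F` folds the double `T` onto one of its
halves `S`, and `u` tells the two halves apart. -/
theorem FourPointOn.double {α : Type*} {S T A : Set α} {d : α → α → ℝ} {δ C : ℝ}
    {F : α → α} {u : α → Prop}
    (h : FourPointOn S d δ) (hd : IsPseudoDistOn T d) (hST : S ⊆ T) (hAS : A ⊆ S)
    (hA : A.Nonempty) (hC : 0 ≤ C) (hP : HasCoarseProj S d A C) (hF : ∀ z ∈ T, F z ∈ S)
    (same : ∀ z ∈ T, ∀ w ∈ T, (u z ↔ u w) → d z w = d (F z) (F w))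
    (diff_le : ∀ z ∈ T, ∀ w ∈ T, ¬ (u z ↔ u w) → ∀ a ∈ A, d z w ≤ d (F z) a + d a (F w))
    (le_diff : ∀ z ∈ T, ∀ w ∈ T, ¬ (u z ↔ u w) → ∃ a ∈ A, d (F z) a + d a (F w) ≤ d z w + 1) :
    FourPointOn T d (4 * (δ + 2 * C + 2)) := by
  have hdS : IsPseudoDistOn S d := hd.mono hST
  obtain ⟨o, ho⟩ := hA
  have hδ : 0 ≤ δ := h.nonneg hdS ⟨o, hAS ho⟩
  choose! P hPA hP using hP
  set g : α → α → ℝ := fun z w => (d o (F z) + d o (F w) - d z w) / 2 with hg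
  set gS : α → α → ℝ := fun x y => (d o x + d o y - d x y) / 2 with hgS
  have L0 : ∀ x ∈ S, ∀ y ∈ S, ∀ v ∈ S, min (gS x v) (gS v y) ≤ gS x y + δ / 2 := by
    intro x hx y hy v hv
    have f := h x hx y hy v hv o (hAS ho)
    have s1 := hdS.symm x hx o (hAS ho)
    have s2 := hdS.symm y hy o (hAS ho)
    have s3 := hdS.symm v hv o (hAS ho)
    have s4 := hdS.symm v hv y hy
    simp only [hgS]
    rcases max_choice (d x v + d y o) (d x o + d y v) with e | e <;> rw [e] at f
    · exact (min_le_left _ _).trans (by linarith)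
    · exact (min_le_right _ _).trans (by linarith)
  have Lpi : ∀ x ∈ S, d o (P x) ≤ d o x - d x (P x) + C := by
    intro x hx
    have := hP x hx o ho
    have s1 := hdS.symm x hx o (hAS ho)
    have s2 := hdS.symm (P x) (hAS (hPA x hx)) o (hAS ho)
    linarith
  have gsymm : ∀ z ∈ T, ∀ w ∈ T, g z w = g w z := by
    intro z hz w hw
    simp only [hg, hd.symm z hz w hw]
    ring
  have gsame : ∀ z ∈ T, ∀ w ∈ T, (u z ↔ u w) → g z w = gS (F z) (F w) := by
    intro z hz w hw hzw
    simp only [hg, hgS, same z hz w hw hzw]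
  have gle : ∀ z ∈ T, ∀ w ∈ T, g z w ≤ gS (F z) (F w) + 1 := by
    intro z hz w hw
    by_cases hzw : u z ↔ u w
    · linarith [gsame z hz w hw hzw]
    · obtain ⟨a, ha, ha'⟩ := le_diff z hz w hw hzw
      have := hdS.triangle _ (hF z hz) a (hAS ha) _ (hF w hw)
      simp only [hg, hgS]
      linarith
  have L1 : ∀ z ∈ T, ∀ w ∈ T, ¬ (u z ↔ u w) →
      g z w ≤ d o (F z) - d (F z) (P (F z)) + C + 1 := by
    intro z hz w hw hzw
    obtain ⟨a, ha, ha'⟩ := le_diff z hz w hw hzw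
    have hx := hF z hz
    have hy := hF w hw
    have i1 := hP _ hx a ha
    have i2 := Lpi _ hx
    have i3 := hdS.triangle o (hAS ho) (P (F z)) (hAS (hPA _ hx)) a (hAS ha)
    have i4 := hdS.triangle o (hAS ho) a (hAS ha) (F w) hy
    simp only [hg]
    linarith
  have L2 : ∀ z ∈ T, ∀ w ∈ T, ¬ (u z ↔ u w) →
      min (d o (F z) - d (F z) (P (F z))) (gS (F z) (F w)) ≤ g z w + δ / 2 + C / 2 := by
    intro z hz w hw hzw
    have hx := hF z hz
    have hy := hF w hw
    have hp := hAS (hPA _ hx)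
    have i1 := diff_le z hz w hw hzw _ (hPA _ hx)
    have i2 := Lpi _ hx
    have i3 := L0 _ hp _ hy _ hx
    have i4 := hdS.triangle o (hAS ho) _ hp _ hx
    have i5 := hdS.symm _ hp _ hx
    have : d o (F z) - d (F z) (P (F z)) ≤ gS (P (F z)) (F z) := by
      simp only [hgS]
      linarith
    have i6 : min (d o (F z) - d (F z) (P (F z))) (gS (F z) (F w)) ≤
      gS (P (F z)) (F w) + δ / 2 := (min_le_min_right _ this).trans i3
    refine i6.trans ?_
    simp only [hg, hgS]
    linarith
  have key : ∀ z ∈ T, ∀ w ∈ T, ∀ v ∈ T, min (g z v) (g v w) ≤ g z w + (δ + 2 * C + 2) := by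
    intro z hz w hw v hv
    have base : min (g z v) (g v w) ≤ gS (F z) (F w) + δ / 2 + 1 := by
      have i1 := L0 _ (hF z hz) _ (hF w hw) _ (hF v hv)
      have i2 := gle z hz v hv
      have i3 := gle v hv w hw
      rcases min_choice (gS (F z) (F v)) (gS (F v) (F w)) with e | e <;> rw [e] at i1
      · exact (min_le_left _ _).trans (by linarith)
      · exact (min_le_right _ _).trans (by linarith)
    by_cases hzw : u z ↔ u w
    · rw [← gsame z hz w hw hzw] at base
      linarith
    · by_cases hzv : u z ↔ u v
      · have hvw : ¬ (u w ↔ u v) := by tauto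
        have i1 := L1 w hw v hv hvw
        have i2 := L2 w hw z hz (by tauto)
        rw [gsymm w hw v hv] at i1
        rw [gsymm w hw z hz, show gS (F w) (F z) = gS (F z) (F w) by
          simp only [hgS, hdS.symm _ (hF z hz) _ (hF w hw)]; ring] at i2
        have i3 := min_le_right (g z v) (g v w)
        rcases min_choice (d o (F w) - d (F w) (P (F w))) (gS (F z) (F w)) with e | e <;>
          rw [e] at i2 <;> linarith
      · have i1 := L1 z hz v hv hzv
        have i2 := L2 z hz w hw hzw
        have i3 := min_le_left (g z v) (g v w)
        rcases min_choice (d o (F z) - d (F z) (P (F z))) (gS (F z) (F w)) with e | e <;>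
          rw [e] at i2 <;> linarith
  intro x hx y hy z hz w hw
  have := add_le_add_of_min_le key gsymm hx hy hz hw
  simp only [hg] at this
  rcases min_le_iff.1 this with e | e
  · refine le_trans ?_ (add_le_add_left (le_max_left _ _) _)
    linarith
  · refine le_trans ?_ (add_le_add_left (le_max_right _ _) _)
    linarith

/-- `ρ` is a continuous nonnegative density on the domain `Ω`. -/
structure IsDensityOn (Ω : Set ℂ) (ρ : ℂ → ℝ) : Prop where
  isOpen : IsOpen Ω
  isConnected : IsConnected Ω
  continuousOn : ContinuousOn ρ Ω
  nonneg : ∀ z ∈ Ω, 0 ≤ ρ z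

/-- `γ` is a `C¹` curve in `Ω` from `z` to `w`. -/
structure IsCurveIn (Ω : Set ℂ) (γ : ℝ → ℂ) (z w : ℂ) : Prop where
  contDiffOn : ContDiffOn ℝ 1 γ (Icc 0 1)
  source : γ 0 = z
  target : γ 1 = w
  mapsTo : ∀ t ∈ Icc (0 : ℝ) 1, γ t ∈ Ω

/-- The speed of the curve `γ` with respect to the density `ρ`. -/
def curveSpeed (ρ : ℂ → ℝ) (γ : ℝ → ℂ) (t : ℝ) : ℝ :=
  ρ (γ t) * ‖derivWithin γ (Icc 0 1) t‖

theorem densityDist_eq_sInf {S : Set ℂ} {ρ : ℂ → ℝ} {z w : ℂ} :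
    densityDist S ρ z w = sInf {L | ∃ γ, IsCurveIn S γ z w ∧ L = curveLen ρ γ} := by
  unfold densityDist
  congr 1
  ext L
  constructor
  · rintro ⟨γ, h1, h2, h3, h4, h5⟩
    exact ⟨γ, ⟨h1, h2, h3, h4⟩, h5⟩
  · rintro ⟨γ, ⟨h1, h2, h3, h4⟩, h5⟩
    exact ⟨γ, h1, h2, h3, h4, h5⟩

theorem derivWithin_Icc_eq_deriv {γ : ℝ → ℂ} {t : ℝ} (ht : t ∈ Ioo (0 : ℝ) 1) :
    derivWithin γ (Icc 0 1) t = deriv γ t :=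
  derivWithin_of_mem_nhds (Icc_mem_nhds ht.1 ht.2)

theorem curveLen_eq_integral_curveSpeed (ρ : ℂ → ℝ) (γ : ℝ → ℂ) :
    curveLen ρ γ = ∫ t in (0:ℝ)..1, curveSpeed ρ γ t := by
  refine intervalIntegral.integral_congr_Ioo_of_le zero_le_one fun t ht => ?_
  simp only [curveSpeed, derivWithin_Icc_eq_deriv ht]

section

variable {Ω : Set ℂ} {ρ : ℂ → ℝ} {γ : ℝ → ℂ} {z w : ℂ}

theorem IsCurveIn.continuousOn (h : IsCurveIn Ω γ z w) : ContinuousOn γ (Icc 0 1) :=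
  h.contDiffOn.continuousOn

theorem IsCurveIn.hasDerivWithinAt (h : IsCurveIn Ω γ z w) {t : ℝ} (ht : t ∈ Icc (0 : ℝ) 1) :
    HasDerivWithinAt γ (derivWithin γ (Icc 0 1) t) (Icc 0 1) t :=
  (h.contDiffOn.differentiableOn one_ne_zero t ht).hasDerivWithinAt

theorem IsCurveIn.continuousOn_curveSpeed (h : IsCurveIn Ω γ z w) (hρ : ContinuousOn ρ Ω) :
    ContinuousOn (curveSpeed ρ γ) (Icc 0 1) :=
  (hρ.comp h.continuousOn h.mapsTo).mul
    (h.contDiffOn.continuousOn_derivWithin (uniqueDiffOn_Icc zero_lt_one) le_rfl).norm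

theorem IsCurveIn.curveSpeed_nonneg (h : IsCurveIn Ω γ z w) (hρ : IsDensityOn Ω ρ) {t : ℝ}
    (ht : t ∈ Icc (0 : ℝ) 1) : 0 ≤ curveSpeed ρ γ t :=
  mul_nonneg (hρ.nonneg _ (h.mapsTo t ht)) (norm_nonneg _)

theorem IsCurveIn.integral_nonneg (h : IsCurveIn Ω γ z w) (hρ : IsDensityOn Ω ρ) {a b : ℝ}
    (ha : 0 ≤ a) (hab : a ≤ b) (hb : b ≤ 1) : 0 ≤ ∫ t in a..b, curveSpeed ρ γ t :=
  intervalIntegral.integral_nonneg hab fun _ ht =>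
    h.curveSpeed_nonneg hρ ⟨ha.trans ht.1, ht.2.trans hb⟩

theorem IsCurveIn.intervalIntegrable (h : IsCurveIn Ω γ z w) (hρ : IsDensityOn Ω ρ) {a b : ℝ}
    (ha : a ∈ Icc (0 : ℝ) 1) (hb : b ∈ Icc (0 : ℝ) 1) :
    IntervalIntegrable (curveSpeed ρ γ) MeasureTheory.volume a b :=
  ((h.continuousOn_curveSpeed hρ.continuousOn).mono
    (uIcc_subset_Icc ha hb)).intervalIntegrable

theorem IsCurveIn.curveLen_nonneg (h : IsCurveIn Ω γ z w) (hρ : IsDensityOn Ω ρ) :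
    0 ≤ curveLen ρ γ := by
  rw [curveLen_eq_integral_curveSpeed]
  exact h.integral_nonneg hρ le_rfl zero_le_one le_rfl

theorem IsCurveIn.densityDist_le (h : IsCurveIn Ω γ z w) (hρ : IsDensityOn Ω ρ) :
    densityDist Ω ρ z w ≤ curveLen ρ γ := by
  rw [densityDist_eq_sInf]
  refine csInf_le ⟨0, ?_⟩ ⟨γ, h, rfl⟩
  rintro _ ⟨η, hη, rfl⟩
  exact hη.curveLen_nonneg hρ

/-- Reparametrizing a curve monotonically. -/
theorem IsCurveIn.integral_comp (h : IsCurveIn Ω γ z w) (hρ : IsDensityOn Ω ρ) {φ : ℝ → ℝ}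
    (hφ : ContDiff ℝ 1 φ) (hm : Monotone φ) {a b : ℝ} (hab : a ≤ b)
    (hφI : ∀ t ∈ Icc a b, φ t ∈ Icc (0 : ℝ) 1) :
    ∫ t in a..b, ρ (γ (φ t)) * ‖deriv (fun s => γ (φ s)) t‖ =
      ∫ t in φ a..φ b, curveSpeed ρ γ t := by
  have hc : ContinuousOn (curveSpeed ρ γ) (φ '' uIcc a b) := by
    refine (h.continuousOn_curveSpeed hρ.continuousOn).mono ?_
    rw [uIcc_of_le hab]
    rintro _ ⟨t, ht, rfl⟩
    exact hφI t ht
  rw [← intervalIntegral.integral_comp_mul_deriv'' (f' := deriv φ) hφ.continuous.continuousOn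
    (fun t _ => ((hφ.differentiable one_ne_zero) t).hasDerivAt.hasDerivWithinAt)
    (hφ.continuous_deriv le_rfl).continuousOn hc]
  refine intervalIntegral.integral_congr_Ioo_of_le hab fun t ht => ?_
  have h1 : HasDerivWithinAt φ (deriv φ t) (Icc a b) t :=
    ((hφ.differentiable one_ne_zero) t).hasDerivAt.hasDerivWithinAt
  have h2 := (h.hasDerivWithinAt (hφI t (Ioo_subset_Icc_self ht))).scomp t h1 hφI
  have h3 : HasDerivAt (fun s => γ (φ s)) _ t := h2.hasDerivAt (Icc_mem_nhds ht.1 ht.2)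
  have h4 : 0 ≤ deriv φ t := hm.deriv_nonneg
  simp only [h3.deriv, norm_smul, Real.norm_eq_abs, abs_of_nonneg h4, Function.comp_apply,
    curveSpeed]
  ring

theorem IsCurveIn.densityDist_le_integral (h : IsCurveIn Ω γ z w) (hρ : IsDensityOn Ω ρ)
    {a b : ℝ} (ha : 0 ≤ a) (hab : a ≤ b) (hb : b ≤ 1) :
    densityDist Ω ρ (γ a) (γ b) ≤ ∫ t in a..b, curveSpeed ρ γ t := by
  have hmem : ∀ t ∈ Icc (0 : ℝ) 1, a + (b - a) * t ∈ Icc (0 : ℝ) 1 := fun t ht =>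
    ⟨by nlinarith [ht.1, ht.2], by nlinarith [ht.1, ht.2]⟩
  have hφ : ContDiff ℝ 1 fun t : ℝ => a + (b - a) * t := by fun_prop
  have hη : IsCurveIn Ω (fun t => γ (a + (b - a) * t)) (γ a) (γ b) :=
    ⟨h.contDiffOn.comp hφ.contDiffOn hmem, by simp, by simp, fun t ht => h.mapsTo _ (hmem t ht)⟩
  refine (hη.densityDist_le hρ).trans_eq ?_
  have := h.integral_comp hρ hφ
    (fun s t hst => by
      have := mul_le_mul_of_nonneg_left hst (sub_nonneg.2 hab)
      simpa using this) zero_le_one hmem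
  simpa [curveLen] using this

theorem isCurveIn_const (hz : z ∈ Ω) : IsCurveIn Ω (fun _ => z) z z :=
  ⟨contDiffOn_const, rfl, rfl, fun _ _ => hz⟩

theorem IsCurveIn.reverse (h : IsCurveIn Ω γ z w) : IsCurveIn Ω (fun t => γ (1 - t)) w z := by
  have hmem : ∀ t ∈ Icc (0 : ℝ) 1, 1 - t ∈ Icc (0 : ℝ) 1 := fun t ht =>
    ⟨by linarith [ht.2], by linarith [ht.1]⟩
  exact ⟨h.contDiffOn.comp (by fun_prop) hmem, by simpa using h.target, by simpa using h.source,
    fun t ht => h.mapsTo _ (hmem t ht)⟩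

theorem curveLen_reverse (ρ : ℂ → ℝ) (γ : ℝ → ℂ) :
    curveLen ρ (fun t => γ (1 - t)) = curveLen ρ γ := by
  have := intervalIntegral.integral_comp_sub_left (a := 0) (b := 1)
    (fun t => ρ (γ t) * ‖deriv γ t‖) 1
  simp only [sub_self, sub_zero] at this
  simp only [curveLen, deriv_comp_const_sub, norm_neg, this]

/-- Two curves in `Ω` can be concatenated. -/
theorem IsCurveIn.exists_concat (hγ : IsCurveIn Ω γ z w) {η : ℝ → ℂ} {v : ℂ}
    (hη : IsCurveIn Ω η w v) :
    ∃ ζ, IsCurveIn Ω ζ z v ∧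
      ∀ ρ, IsDensityOn Ω ρ → curveLen ρ ζ = curveLen ρ γ + curveLen ρ η := by
  set φ : ℝ → ℝ := fun t => Real.smoothTransition (2 * t) with hφ
  set ψ : ℝ → ℝ := fun t => Real.smoothTransition (2 * t - 1) with hψ
  have cφ : ContDiff ℝ 1 φ := Real.smoothTransition.contDiff.comp (by fun_prop)
  have cψ : ContDiff ℝ 1 ψ := Real.smoothTransition.contDiff.comp (by fun_prop)
  have mφ : Monotone φ := fun s t hst => Real.smoothTransition.monotone (by linarith)
  have mψ : Monotone ψ := fun s t hst => Real.smoothTransition.monotone (by linarith)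
  have iφ : ∀ t, φ t ∈ Icc (0 : ℝ) 1 := fun t =>
    ⟨Real.smoothTransition.nonneg _, Real.smoothTransition.le_one _⟩
  have iψ : ∀ t, ψ t ∈ Icc (0 : ℝ) 1 := fun t =>
    ⟨Real.smoothTransition.nonneg _, Real.smoothTransition.le_one _⟩
  have φ1 : ∀ t, 1 / 2 ≤ t → φ t = 1 := fun t ht =>
    Real.smoothTransition.one_of_one_le (by linarith)
  have ψ0 : ∀ t, t ≤ 1 / 2 → ψ t = 0 := fun t ht =>
    Real.smoothTransition.zero_of_nonpos (by linarith)
  have φ0 : φ 0 = 0 := Real.smoothTransition.zero_of_nonpos (by simp)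
  have ψ1 : ψ 1 = 1 := Real.smoothTransition.one_of_one_le (by norm_num)
  set ζ : ℝ → ℂ := fun t => γ (φ t) + η (ψ t) - w with hζ
  have ζl : ∀ t, t ≤ 1 / 2 → ζ t = γ (φ t) := fun t ht => by
    simp [hζ, ψ0 t ht, hη.source]
  have ζr : ∀ t, 1 / 2 ≤ t → ζ t = η (ψ t) := fun t ht => by
    simp [hζ, φ1 t ht, hγ.target]
  have hcurve : IsCurveIn Ω ζ z v := by
    refine ⟨?_, ?_, ?_, ?_⟩
    · exact ((hγ.contDiffOn.comp cφ.contDiffOn fun t _ => iφ t).add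
        (hη.contDiffOn.comp cψ.contDiffOn fun t _ => iψ t)).sub contDiffOn_const
    · rw [ζl 0 (by norm_num), φ0, hγ.source]
    · rw [ζr 1 (by norm_num), ψ1, hη.target]
    · intro t ht
      rcases le_total t (1 / 2) with h | h
      · rw [ζl t h]
        exact hγ.mapsTo _ (iφ t)
      · rw [ζr t h]
        exact hη.mapsTo _ (iψ t)
  refine ⟨ζ, hcurve, fun ρ hρ => ?_⟩
  have hl : ∫ t in (0:ℝ)..(1/2), curveSpeed ρ ζ t = curveLen ρ γ := by
    have := hγ.integral_comp hρ cφ mφ (a := 0) (b := 1 / 2) (by norm_num) fun t _ => iφ t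
    rw [φ0, φ1 _ le_rfl, ← curveLen_eq_integral_curveSpeed] at this
    rw [← this]
    refine intervalIntegral.integral_congr_Ioo_of_le (by norm_num) fun t ht => ?_
    have he : ζ =ᶠ[nhds t] fun s => γ (φ s) := by
      filter_upwards [Iio_mem_nhds ht.2] with s hs using ζl s (le_of_lt hs)
    simp only [curveSpeed]
    rw [derivWithin_Icc_eq_deriv ⟨ht.1, by linarith [ht.2]⟩, he.deriv_eq, he.eq_of_nhds]
  have hr : ∫ t in (1/2:ℝ)..1, curveSpeed ρ ζ t = curveLen ρ η := by
    have := hη.integral_comp hρ cψ mψ (a := 1 / 2) (b := 1) (by norm_num) fun t _ => iψ t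
    rw [ψ1, ψ0 _ le_rfl, ← curveLen_eq_integral_curveSpeed] at this
    rw [← this]
    refine intervalIntegral.integral_congr_Ioo_of_le (by norm_num) fun t ht => ?_
    have he : ζ =ᶠ[nhds t] fun s => η (ψ s) := by
      filter_upwards [Ioi_mem_nhds ht.1] with s hs using ζr s (le_of_lt hs)
    simp only [curveSpeed]
    rw [derivWithin_Icc_eq_deriv ⟨by linarith [ht.1], ht.2⟩, he.deriv_eq, he.eq_of_nhds]
  rw [curveLen_eq_integral_curveSpeed, ← hl, ← hr]
  refine (intervalIntegral.integral_add_adjacent_intervals ?_ ?_).symm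
  · exact hcurve.intervalIntegrable hρ ⟨le_rfl, zero_le_one⟩ ⟨by norm_num, by norm_num⟩
  · exact hcurve.intervalIntegrable hρ ⟨by norm_num, by norm_num⟩ ⟨zero_le_one, le_rfl⟩

theorem isCurveIn_segment (h : segment ℝ z w ⊆ Ω) :
    IsCurveIn Ω (fun t => z + (t : ℂ) * (w - z)) z w := by
  refine ⟨?_, by simp, by simp, fun t ht => h ?_⟩
  · exact ((contDiff_const.add (ofRealCLM.contDiff.mul contDiff_const))).contDiffOn
  · rw [segment_eq_image']
    exact ⟨t, ht, by simp⟩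

theorem deriv_segment (t : ℝ) : deriv (fun t : ℝ => z + (t : ℂ) * (w - z)) t = w - z := by
  have h : HasDerivAt (fun t : ℝ => z + (t : ℂ) * (w - z)) (1 * (w - z)) t :=
    (((hasDerivAt_id t).ofReal_comp).mul_const (w - z)).const_add z
  simpa using h.deriv

end

section

variable {Ω : Set ℂ} {ρ : ℂ → ℝ} {γ : ℝ → ℂ} {x y z w : ℂ}

/-- A bound for the distance along a curve whose speed is bounded by a derivative. -/
theorem IsCurveIn.densityDist_le_sub (h : IsCurveIn Ω γ z w) (hρ : IsDensityOn Ω ρ)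
    {B B' : ℝ → ℝ} (hB : ∀ t ∈ Icc (0 : ℝ) 1, HasDerivAt B (B' t) t)
    (hle : ∀ t ∈ Ioo (0 : ℝ) 1, ρ (γ t) * ‖deriv γ t‖ ≤ B' t) :
    densityDist Ω ρ z w ≤ B 1 - B 0 := by
  refine (h.densityDist_le hρ).trans ?_
  rw [curveLen_eq_integral_curveSpeed]
  refine intervalIntegral.integral_le_sub_of_hasDeriv_right_of_le zero_le_one
    (fun t ht => (hB t ht).continuousAt.continuousWithinAt)
    (fun t ht => (hB t (Ioo_subset_Icc_self ht)).hasDerivWithinAt)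
    (h.continuousOn_curveSpeed hρ.continuousOn).integrableOn_Icc fun t ht => ?_
  rw [curveSpeed, derivWithin_Icc_eq_deriv ht]
  exact hle t ht

theorem IsDensityOn.exists_isCurveIn (hρ : IsDensityOn Ω ρ) (hz : z ∈ Ω) (hw : w ∈ Ω) :
    ∃ γ, IsCurveIn Ω γ z w := by
  refine IsPreconnected.induction₂ (P := fun z w => ∃ γ, IsCurveIn Ω γ z w)
    hρ.isConnected.isPreconnected ?_ ?_ ?_ hz hw
  · intro u hu
    obtain ⟨r, hr, hb⟩ := Metric.isOpen_iff.1 hρ.isOpen u hu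
    filter_upwards [mem_nhdsWithin_of_mem_nhds (ball_mem_nhds u hr)] with v hv
    exact ⟨_, isCurveIn_segment
      (((convex_ball u r).segment_subset (mem_ball_self hr) hv).trans hb)⟩
  · rintro a b c - - - ⟨γ, hγ⟩ ⟨η, hη⟩
    obtain ⟨ζ, hζ, -⟩ := hγ.exists_concat hη
    exact ⟨ζ, hζ⟩
  · rintro a b - - ⟨γ, hγ⟩
    exact ⟨_, hγ.reverse⟩

/-- Almost length-minimizing curves exist. -/
theorem IsDensityOn.exists_curveLen_lt (hρ : IsDensityOn Ω ρ) (hz : z ∈ Ω) (hw : w ∈ Ω)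
    {ε : ℝ} (hε : 0 < ε) :
    ∃ γ, IsCurveIn Ω γ z w ∧ curveLen ρ γ < densityDist Ω ρ z w + ε := by
  obtain ⟨η, hη⟩ := hρ.exists_isCurveIn hz hw
  have hne : {L | ∃ γ, IsCurveIn Ω γ z w ∧ L = curveLen ρ γ}.Nonempty := ⟨_, η, hη, rfl⟩
  obtain ⟨_, ⟨γ, hγ, rfl⟩, hlt⟩ := exists_lt_of_csInf_lt hne (lt_add_of_pos_right _ hε)
  exact ⟨γ, hγ, by rwa [densityDist_eq_sInf]⟩

theorem IsDensityOn.isPseudoDistOn (hρ : IsDensityOn Ω ρ) :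
    IsPseudoDistOn Ω (densityDist Ω ρ) := by
  have hnn : ∀ z ∈ Ω, ∀ w ∈ Ω, 0 ≤ densityDist Ω ρ z w := by
    intro z _ w _
    rw [densityDist_eq_sInf]
    refine Real.sInf_nonneg ?_
    rintro _ ⟨γ, hγ, rfl⟩
    exact hγ.curveLen_nonneg hρ
  have hsym : ∀ z ∈ Ω, ∀ w ∈ Ω, densityDist Ω ρ w z ≤ densityDist Ω ρ z w := by
    intro z hz w hw
    refine le_of_forall_pos_le_add fun ε hε => ?_
    obtain ⟨γ, hγ, hl⟩ := hρ.exists_curveLen_lt hz hw hε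
    refine (hγ.reverse.densityDist_le hρ).trans ?_
    rw [curveLen_reverse]
    exact hl.le
  refine ⟨hnn, ?_, ?_, ?_⟩
  · intro z hz
    refine le_antisymm (((isCurveIn_const hz).densityDist_le hρ).trans_eq ?_) (hnn z hz z hz)
    simp [curveLen]
  · exact fun z hz w hw => le_antisymm (hsym w hw z hz) (hsym z hz w hw)
  · intro z hz w hw v hv
    refine le_of_forall_pos_le_add fun ε hε => ?_
    obtain ⟨γ, hγ, hl⟩ := hρ.exists_curveLen_lt hz hw (half_pos hε)
    obtain ⟨η, hη, hl'⟩ := hρ.exists_curveLen_lt hw hv (half_pos hε)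
    obtain ⟨ζ, hζ, hlen⟩ := hγ.exists_concat hη
    have := hζ.densityDist_le hρ
    rw [hlen ρ hρ] at this
    linarith

theorem IsDensityOn.densityDist_le_of_segment (hρ : IsDensityOn Ω ρ) (h : segment ℝ z w ⊆ Ω)
    {M : ℝ} (hM : ∀ u ∈ segment ℝ z w, ρ u ≤ M) : densityDist Ω ρ z w ≤ M * ‖w - z‖ := by
  refine ((isCurveIn_segment h).densityDist_le_sub hρ (B := fun t => M * ‖w - z‖ * t)
    (B' := fun _ => M * ‖w - z‖) (fun t _ => ?_) fun t ht => ?_).trans_eq (by simp)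
  · simpa using (hasDerivAt_id t).const_mul (M * ‖w - z‖)
  · rw [deriv_segment]
    refine mul_le_mul_of_nonneg_right (hM _ ?_) (norm_nonneg _)
    rw [segment_eq_image']
    exact ⟨t, Ioo_subset_Icc_self ht, by simp⟩

theorem IsDensityOn.tendsto_densityDist (hρ : IsDensityOn Ω ρ) (hz : z ∈ Ω) :
    Tendsto (fun w => densityDist Ω ρ z w) (nhds z) (nhds 0) := by
  have h1 : ∀ᶠ u in nhds z, ρ u < ρ z + 1 :=
    (hρ.continuousOn.continuousAt (hρ.isOpen.mem_nhds hz)).eventually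
      (gt_mem_nhds (lt_add_one _))
  obtain ⟨r, hr, hb⟩ := Metric.eventually_nhds_iff_ball.1 (h1.and (hρ.isOpen.mem_nhds hz))
  have h2 : Tendsto (fun w => (ρ z + 1) * ‖w - z‖) (nhds z) (nhds 0) := by
    have : Continuous fun w => (ρ z + 1) * ‖w - z‖ := by fun_prop
    simpa using this.tendsto z
  refine squeeze_zero' ?_ ?_ h2
  · filter_upwards [ball_mem_nhds z hr] with w hw
    exact hρ.isPseudoDistOn.nonneg z hz w (hb w hw).2
  · filter_upwards [ball_mem_nhds z hr] with w hw
    have hs := (convex_ball z r).segment_subset (mem_ball_self hr) hw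
    exact hρ.densityDist_le_of_segment (fun u hu => (hb u (hs hu)).2)
      fun u hu => (hb u (hs hu)).1.le

theorem IsDensityOn.continuousOn_densityDist (hρ : IsDensityOn Ω ρ) (hz : z ∈ Ω) :
    ContinuousOn (fun w => densityDist Ω ρ z w) Ω := by
  have hd := hρ.isPseudoDistOn
  intro w hw
  rw [ContinuousWithinAt, tendsto_iff_dist_tendsto_zero]
  refine squeeze_zero' (Eventually.of_forall fun _ => dist_nonneg) ?_
    ((hρ.tendsto_densityDist hw).mono_left nhdsWithin_le_nhds)
  filter_upwards [self_mem_nhdsWithin] with v hv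
  rw [Real.dist_eq, abs_le]
  have h1 := hd.triangle z hz w hw v hv
  have h2 := hd.triangle z hz v hv w hw
  rw [hd.symm v hv w hw] at h2
  constructor <;> linarith

end

/-- `ρ` is a density on a domain symmetric about the real axis and invariant under complex
conjugation. -/
structure IsSymmDensityOn (Ω : Set ℂ) (ρ : ℂ → ℝ) : Prop extends IsDensityOn Ω ρ where
  conj_mem : ∀ z ∈ Ω, (starRingEnd ℂ) z ∈ Ω
  map_conj : ∀ z ∈ Ω, ρ ((starRingEnd ℂ) z) = ρ z

/-- The folding of the plane onto the closed upper half-plane. -/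
def upperFold (z : ℂ) : ℂ := if 0 ≤ z.im then z else (starRingEnd ℂ) z

theorem upperFold_of_nonneg {z : ℂ} (h : 0 ≤ z.im) : upperFold z = z := if_pos h

theorem upperFold_eq (z : ℂ) : upperFold z = ⟨z.re, |z.im|⟩ := by
  unfold upperFold
  split_ifs with h
  · rw [abs_of_nonneg h]
  · rw [abs_of_neg (not_le.1 h)]
    rfl

section

variable {Ω : Set ℂ} {ρ : ℂ → ℝ} {γ : ℝ → ℂ} {x y z w : ℂ}

theorem IsSymmDensityOn.densityDist_conj_le (h : IsSymmDensityOn Ω ρ) (hz : z ∈ Ω) (hw : w ∈ Ω) :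
    densityDist Ω ρ ((starRingEnd ℂ) z) ((starRingEnd ℂ) w) ≤ densityDist Ω ρ z w := by
  refine le_of_forall_pos_le_add fun ε hε => ?_
  obtain ⟨γ, hγ, hl⟩ := h.exists_curveLen_lt hz hw hε
  have hη : IsCurveIn Ω (fun t => (starRingEnd ℂ) (γ t)) ((starRingEnd ℂ) z)
      ((starRingEnd ℂ) w) :=
    ⟨conjCLE.contDiff.comp_contDiffOn hγ.contDiffOn, by rw [hγ.source], by rw [hγ.target],
      fun t ht => h.conj_mem _ (hγ.mapsTo t ht)⟩
  refine (hη.densityDist_le h.toIsDensityOn).trans (le_trans (le_of_eq ?_) hl.le)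
  refine intervalIntegral.integral_congr_Ioo_of_le zero_le_one fun t ht => ?_
  have h1 : HasDerivAt γ (derivWithin γ (Icc 0 1) t) t :=
    (hγ.hasDerivWithinAt (Ioo_subset_Icc_self ht)).hasDerivAt (Icc_mem_nhds ht.1 ht.2)
  have h2 : HasDerivAt (fun t => (starRingEnd ℂ) (γ t))
      ((starRingEnd ℂ) (derivWithin γ (Icc 0 1) t)) t :=
    conjCLE.toContinuousLinearMap.hasFDerivAt.comp_hasDerivAt t h1
  simp only [h2.deriv, h1.deriv, h.map_conj _ (hγ.mapsTo t (Ioo_subset_Icc_self ht)),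
    RCLike.norm_conj]

theorem IsSymmDensityOn.densityDist_conj (h : IsSymmDensityOn Ω ρ) (hz : z ∈ Ω) (hw : w ∈ Ω) :
    densityDist Ω ρ ((starRingEnd ℂ) z) ((starRingEnd ℂ) w) = densityDist Ω ρ z w := by
  refine le_antisymm (h.densityDist_conj_le hz hw) ?_
  simpa using h.densityDist_conj_le (h.conj_mem z hz) (h.conj_mem w hw)

theorem IsSymmDensityOn.upperFold_mem (h : IsSymmDensityOn Ω ρ) (hz : z ∈ Ω) :
    upperFold z ∈ Ω := by
  unfold upperFold
  split_ifs
  exacts [hz, h.conj_mem z hz]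

theorem upperFold_im_nonneg (z : ℂ) : 0 ≤ (upperFold z).im := by
  rw [upperFold_eq]
  exact abs_nonneg _

theorem IsSymmDensityOn.densityDist_upperFold_real (h : IsSymmDensityOn Ω ρ) (hz : z ∈ Ω)
    {a : ℂ} (ha : a ∈ Ω) (ha' : a.im = 0) :
    densityDist Ω ρ (upperFold z) a = densityDist Ω ρ z a := by
  unfold upperFold
  split_ifs
  · rfl
  · rw [← h.densityDist_conj hz ha, conj_eq_iff_im.2 ha']

theorem IsSymmDensityOn.densityDist_upperFold_of_iff (h : IsSymmDensityOn Ω ρ) (hz : z ∈ Ω)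
    (hw : w ∈ Ω) (hzw : 0 ≤ z.im ↔ 0 ≤ w.im) :
    densityDist Ω ρ (upperFold z) (upperFold w) = densityDist Ω ρ z w := by
  unfold upperFold
  by_cases hz' : 0 ≤ z.im
  · rw [if_pos hz', if_pos (hzw.1 hz')]
  · rw [if_neg hz', if_neg (mt hzw.2 hz'), h.densityDist_conj hz hw]

/-- A path joining points on different sides crosses the real axis. -/
theorem IsDensityOn.exists_real_between (h : IsDensityOn Ω ρ) (hz : z ∈ Ω) (hw : w ∈ Ω)
    (hz' : 0 ≤ z.im) (hw' : w.im ≤ 0) {ε : ℝ} (hε : 0 < ε) :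
    ∃ a ∈ Ω, a.im = 0 ∧
      densityDist Ω ρ z a + densityDist Ω ρ a w ≤ densityDist Ω ρ z w + ε := by
  obtain ⟨γ, hγ, hl⟩ := h.exists_curveLen_lt hz hw hε
  have hc : ContinuousOn (fun t => (γ t).im) (Icc 0 1) :=
    continuous_im.comp_continuousOn hγ.continuousOn
  obtain ⟨t, ht, ht0⟩ := intermediate_value_Icc' zero_le_one hc
    (show (0 : ℝ) ∈ Icc _ _ from ⟨by simpa [hγ.target], by simpa [hγ.source]⟩)
  refine ⟨γ t, hγ.mapsTo t ht, ht0, ?_⟩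
  have h1 := hγ.densityDist_le_integral h le_rfl ht.1 ht.2
  have h2 := hγ.densityDist_le_integral h ht.1 ht.2 le_rfl
  have h3 := intervalIntegral.integral_add_adjacent_intervals
    (hγ.intervalIntegrable h ⟨le_rfl, zero_le_one⟩ ht)
    (hγ.intervalIntegrable h ht ⟨zero_le_one, le_rfl⟩)
  rw [← curveLen_eq_integral_curveSpeed] at h3
  rw [hγ.source] at h1
  rw [hγ.target] at h2
  linarith

theorem IsSymmDensityOn.exists_real_between_of_not_iff (h : IsSymmDensityOn Ω ρ) (hz : z ∈ Ω)
    (hw : w ∈ Ω) (hzw : ¬ (0 ≤ z.im ↔ 0 ≤ w.im)) {ε : ℝ} (hε : 0 < ε) :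
    ∃ a ∈ Ω, a.im = 0 ∧ densityDist Ω ρ (upperFold z) a + densityDist Ω ρ a (upperFold w)
      ≤ densityDist Ω ρ z w + ε := by
  have hd := h.isPseudoDistOn
  suffices ∃ a ∈ Ω, a.im = 0 ∧
      densityDist Ω ρ z a + densityDist Ω ρ a w ≤ densityDist Ω ρ z w + ε by
    obtain ⟨a, ha, ha', hle⟩ := this
    refine ⟨a, ha, ha', ?_⟩
    rwa [h.densityDist_upperFold_real hz ha ha',
      hd.symm a ha _ (h.upperFold_mem hw), h.densityDist_upperFold_real hw ha ha',
      hd.symm w hw a ha]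
  rcases le_or_gt 0 z.im with hz' | hz'
  · have hw' : ¬ 0 ≤ w.im := fun h' => hzw ⟨fun _ => h', fun _ => hz'⟩
    exact h.exists_real_between hz hw hz' (not_le.1 hw').le hε
  · have hw' : 0 ≤ w.im := by
      by_contra h'
      exact hzw ⟨fun h1 => absurd h1 (not_le.2 hz'), fun h1 => absurd h1 h'⟩
    obtain ⟨a, ha, ha', hle⟩ := h.exists_real_between hw hz hw' hz'.le hε
    refine ⟨a, ha, ha', ?_⟩
    rw [hd.symm z hz a ha, hd.symm a ha w hw, hd.symm z hz w hw]
    linarith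

/-- The folding map is `1`-Lipschitz. -/
theorem IsSymmDensityOn.densityDist_upperFold_le (h : IsSymmDensityOn Ω ρ) (hz : z ∈ Ω)
    (hw : w ∈ Ω) : densityDist Ω ρ (upperFold z) (upperFold w) ≤ densityDist Ω ρ z w := by
  by_cases hzw : 0 ≤ z.im ↔ 0 ≤ w.im
  · exact (h.densityDist_upperFold_of_iff hz hw hzw).le
  · refine le_of_forall_pos_le_add fun ε hε => ?_
    obtain ⟨a, ha, -, hle⟩ := h.exists_real_between_of_not_iff hz hw hzw hε
    exact (h.isPseudoDistOn.triangle _ (h.upperFold_mem hz) a ha _ (h.upperFold_mem hw)).trans hle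

/-- Hyperbolicity of the upper half of a symmetric domain and a coarse projection to the real
part give hyperbolicity of the whole domain. -/
theorem IsSymmDensityOn.fourPointOn (h : IsSymmDensityOn Ω ρ) {δ C : ℝ} (hC : 0 ≤ C)
    (h4 : FourPointOn {z | z ∈ Ω ∧ 0 ≤ z.im} (densityDist Ω ρ) δ)
    (hA : {z | z ∈ Ω ∧ z.im = 0}.Nonempty)
    (hP : HasCoarseProj {z | z ∈ Ω ∧ 0 ≤ z.im} (densityDist Ω ρ) {z | z ∈ Ω ∧ z.im = 0} C) :
    FourPointOn Ω (densityDist Ω ρ) (4 * (δ + 2 * C + 2)) := by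
  have hd := h.isPseudoDistOn
  refine h4.double (F := upperFold) (u := fun z => 0 ≤ z.im) hd (fun z hz => hz.1)
    (fun z hz => ⟨hz.1, hz.2.ge⟩) hA hC hP
    (fun z hz => ⟨h.upperFold_mem hz, upperFold_im_nonneg z⟩)
    (fun z hz w hw hzw => (h.densityDist_upperFold_of_iff hz hw hzw).symm) ?_ ?_
  · rintro z hz w hw - a ⟨ha, ha'⟩
    rw [h.densityDist_upperFold_real hz ha ha', hd.symm a ha _ (h.upperFold_mem hw),
      h.densityDist_upperFold_real hw ha ha', hd.symm w hw a ha]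
    exact hd.triangle z hz a ha w hw
  · intro z hz w hw hzw
    obtain ⟨a, ha, ha', hle⟩ := h.exists_real_between_of_not_iff hz hw hzw zero_lt_one
    exact ⟨a, ⟨ha, ha'⟩, hle⟩

end

/-- The copy of a set of reals on the real axis of the plane. -/
def realCopy (J : Set ℝ) : Set ℂ := {z | z.im = 0 ∧ z.re ∈ J}

theorem ofReal_mem_realCopy {J : Set ℝ} {t : ℝ} : (t : ℂ) ∈ realCopy J ↔ t ∈ J := by
  simp [realCopy]

theorem exists_ofReal_of_mem_realCopy {J : Set ℝ} {z : ℂ} (h : z ∈ realCopy J) :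
    ∃ t ∈ J, (t : ℂ) = z :=
  ⟨z.re, h.2, Complex.ext (by simp) (by simp [h.1])⟩

theorem HasCoarseProj.mono {α : Type*} {S A : Set α} {d : α → α → ℝ} {C C' : ℝ}
    (h : HasCoarseProj S d A C) (hC : C ≤ C') : HasCoarseProj S d A C' := fun x hx => by
  obtain ⟨p, hp, h'⟩ := h x hx
  exact ⟨p, hp, fun a ha => (h' a ha).trans (by linarith)⟩

/-- An interval of the real axis along which the distance is coarsely additive has coarse
projections. -/
theorem IsDensityOn.hasCoarseProj_realCopy {Ω : Set ℂ} {ρ : ℂ → ℝ} (h : IsDensityOn Ω ρ)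
    {δ C : ℝ} (h4 : FourPointOn {z | z ∈ Ω ∧ 0 ≤ z.im} (densityDist Ω ρ) δ) {J : Set ℝ}
    (hJ : J.OrdConnected) (hne : J.Nonempty) (hJΩ : ∀ t ∈ J, (t : ℂ) ∈ Ω) (hC : 0 ≤ C)
    (hadd : ∀ p ∈ J, ∀ q ∈ J, ∀ a ∈ J, p < q → q < a →
      densityDist Ω ρ p q + densityDist Ω ρ q a ≤ densityDist Ω ρ p a + C) :
    HasCoarseProj {z | z ∈ Ω ∧ 0 ≤ z.im} (densityDist Ω ρ) (realCopy J) (2 * (C + δ + 1)) := by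
  have hd := h.isPseudoDistOn
  have hadd' : ∀ p ∈ J, ∀ q ∈ J, ∀ a ∈ J, p ≤ q → q ≤ a →
      densityDist Ω ρ p q + densityDist Ω ρ q a ≤ densityDist Ω ρ p a + C := by
    intro p hp q hq a ha hpq hqa
    rcases hpq.eq_or_lt with rfl | hpq
    · rw [hd.self _ (hJΩ _ hp)]
      linarith
    rcases hqa.eq_or_lt with rfl | hqa
    · rw [hd.self _ (hJΩ _ hq)]
      linarith
    exact hadd p hp q hq a ha hpq hqa
  have hsub : realCopy J ⊆ {z | z ∈ Ω ∧ 0 ≤ z.im} := by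
    intro z hz
    obtain ⟨t, ht, rfl⟩ := exists_ofReal_of_mem_realCopy hz
    exact ⟨hJΩ t ht, by simp⟩
  refine HasCoarseProj.of_between h4 (hd.mono fun z hz => hz.1) hsub ?_ hC ?_
  · obtain ⟨t, ht⟩ := hne
    exact ⟨t, ofReal_mem_realCopy.2 ht⟩
  · intro p' hp' a' ha' t ht
    obtain ⟨p, hp, rfl⟩ := exists_ofReal_of_mem_realCopy hp'
    obtain ⟨a, ha, rfl⟩ := exists_ofReal_of_mem_realCopy ha'
    have hI : uIcc p a ⊆ J := hJ.uIcc_subset hp ha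
    have hcont : ContinuousOn (fun s : ℝ => densityDist Ω ρ p s) (uIcc p a) :=
      (h.continuousOn_densityDist (hJΩ p hp)).comp continuous_ofReal.continuousOn
        fun s hs => hJΩ s (hI hs)
    have hmem := intermediate_value_uIcc hcont
    rw [hd.self _ (hJΩ p hp), uIcc_of_le (hd.nonneg _ (hJΩ p hp) _ (hJΩ a ha))] at hmem
    obtain ⟨q, hq, hqt⟩ := hmem ht
    refine ⟨q, ofReal_mem_realCopy.2 (hI hq), hqt, ?_⟩
    rcases mem_uIcc.1 hq with ⟨h1, h2⟩ | ⟨h1, h2⟩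
    · have := hadd' p hp q (hI hq) a ha h1 h2
      simp only at hqt
      linarith
    · have := hadd' a ha q (hI hq) p hp h1 h2
      rw [hd.symm a (hJΩ _ ha) q (hJΩ _ (hI hq)), hd.symm a (hJΩ _ ha) p (hJΩ _ hp),
        hd.symm q (hJΩ _ (hI hq)) p (hJΩ _ hp)] at this
      simp only at hqt
      linarith

/-- The constant of the coarse projection to a union of `n + 1` consecutive intervals. -/
def projConst (C δ c : ℝ) : ℕ → ℝ
  | 0 => 2 * (C + δ + 1)
  | n + 1 => 3 * projConst C δ c n + 2 * c + 3 * δ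

theorem le_projConst {C δ c : ℝ} (hC : 0 ≤ C) (hδ : 0 ≤ δ) (hc : 0 ≤ c) (n : ℕ) :
    2 * (C + δ + 1) ≤ projConst C δ c n := by
  induction n with
  | zero => exact le_rfl
  | succ n ih =>
    simp only [projConst]
    linarith

/-- Reduction of the hyperbolicity of a symmetric domain to its upper half. -/
theorem IsSymmDensityOn.gromovHyperbolicWith {Ω : Set ℂ} {ρ : ℂ → ℝ} (h : IsSymmDensityOn Ω ρ)
    {δ C c₀ : ℝ} (hC : 0 ≤ C) (h4 : FourPointOn {z | z ∈ Ω ∧ 0 ≤ z.im} (densityDist Ω ρ) δ)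
    {N : ℕ} {I : ℕ → Set ℝ} (hN : 1 ≤ N)
    (hI : ∀ n, n < N → (I n).Nonempty ∧ IsOpen (I n) ∧ (I n).OrdConnected)
    (hΩ : (fun x : ℝ => (x : ℂ)) ⁻¹' Ω = ⋃ n < N, I n)
    (hadd : ∀ n < N, ∀ p ∈ I n, ∀ q ∈ I n, ∀ a ∈ I n, p < q → q < a →
      densityDist Ω ρ p q + densityDist Ω ρ q a ≤ densityDist Ω ρ p a + C)
    (hdist : ∀ n, n + 1 < N →
      setDistFor (densityDist Ω ρ) (realCopy (I n)) (realCopy (I (n + 1))) ≤ c₀) :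
    GromovHyperbolicWith Ω (densityDist Ω ρ)
      (2 * (4 * (δ + 2 * projConst C δ (|c₀| + 1) (N - 1) + 2))) := by
  have hd := h.isPseudoDistOn
  have hIΩ : ∀ n < N, ∀ t ∈ I n, (t : ℂ) ∈ Ω := fun n hn t ht => by
    have : t ∈ (fun x : ℝ => (x : ℂ)) ⁻¹' Ω := by
      rw [hΩ]
      exact mem_iUnion₂.2 ⟨n, hn, ht⟩
    exact this
  have hsub : ∀ n < N, realCopy (I n) ⊆ {z | z ∈ Ω ∧ 0 ≤ z.im} := by
    intro n hn z hz
    obtain ⟨t, ht, rfl⟩ := exists_ofReal_of_mem_realCopy hz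
    exact ⟨hIΩ n hn t ht, by simp⟩
  obtain ⟨t₀, ht₀⟩ := (hI 0 hN).1
  have hdX : IsPseudoDistOn {z | z ∈ Ω ∧ 0 ≤ z.im} (densityDist Ω ρ) := hd.mono fun z hz => hz.1
  have hδ : 0 ≤ δ := h4.nonneg hdX ⟨t₀, hIΩ 0 hN t₀ ht₀, by simp⟩
  have hc : 0 ≤ |c₀| + 1 := by positivity
  have hproj : ∀ n < N, HasCoarseProj {z | z ∈ Ω ∧ 0 ≤ z.im} (densityDist Ω ρ)
      (⋃ m ≤ n, realCopy (I m)) (projConst C δ (|c₀| + 1) n) := by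
    intro n
    induction n with
    | zero =>
      intro hn
      simpa [projConst] using h.hasCoarseProj_realCopy h4 (hI 0 hn).2.2 (hI 0 hn).1 (hIΩ 0 hn) hC (hadd 0 hn)
    | succ n ih =>
      intro hn
      have hA := ih (n.lt_succ_self.trans hn)
      have hB := (h.hasCoarseProj_realCopy h4 (hI _ hn).2.2 (hI _ hn).1 (hIΩ _ hn) hC
        (hadd _ hn)).mono (le_projConst hC hδ hc n)
      have hU : (⋃ m ≤ n + 1, realCopy (I m)) =
          (⋃ m ≤ n, realCopy (I m)) ∪ realCopy (I (n + 1)) := by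
        ext z
        simp only [mem_iUnion, mem_union, exists_prop]
        constructor
        · rintro ⟨m, hm, hz⟩
          rcases Nat.le_succ_iff.1 hm with hm | rfl
          exacts [Or.inl ⟨m, hm, hz⟩, Or.inr hz]
        · rintro (⟨m, hm, hz⟩ | hz)
          exacts [⟨m, hm.trans n.le_succ, hz⟩, ⟨n + 1, le_rfl, hz⟩]
      rw [hU]
      refine HasCoarseProj.union h4 hdX ?_ (hsub _ hn) hA hB hc ?_ ?_
      · exact iUnion₂_subset fun m hm => hsub m (hm.trans_lt (n.lt_succ_self.trans hn))
      · have := le_projConst hC hδ hc n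
        linarith
      · have hne : {r : ℝ | ∃ x ∈ realCopy (I n), ∃ y ∈ realCopy (I (n + 1)),
            r = densityDist Ω ρ x y}.Nonempty := by
          obtain ⟨s, hs⟩ := (hI n (n.lt_succ_self.trans hn)).1
          obtain ⟨t, ht⟩ := (hI _ hn).1
          exact ⟨_, s, ofReal_mem_realCopy.2 hs, t, ofReal_mem_realCopy.2 ht, rfl⟩
        obtain ⟨_, ⟨x, hx, y, hy, rfl⟩, hlt⟩ := exists_lt_of_csInf_lt hne
          ((hdist n hn).trans_lt (lt_add_one c₀))
        refine ⟨x, mem_iUnion₂.2 ⟨n, le_rfl, hx⟩, y, hy, ?_⟩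
        have := le_abs_self c₀
        linarith
  have hA : {z : ℂ | z ∈ Ω ∧ z.im = 0} = ⋃ m ≤ N - 1, realCopy (I m) := by
    ext z
    simp only [mem_iUnion, exists_prop, mem_ofPred_eq]
    constructor
    · rintro ⟨hz, hz'⟩
      have h1 : z.re ∈ (fun x : ℝ => (x : ℂ)) ⁻¹' Ω := by
        have : ((z.re : ℝ) : ℂ) = z := Complex.ext (by simp) (by simp [hz'])
        simpa [this] using hz
      rw [hΩ] at h1
      obtain ⟨m, hm, h2⟩ := mem_iUnion₂.1 h1
      exact ⟨m, by omega, hz', h2⟩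
    · rintro ⟨m, hm, hz⟩
      exact ⟨(hsub m (by omega) hz).1, hz.1⟩
  refine FourPointOn.gromovHyperbolicWith (h.fourPointOn ?_ h4 ?_ ?_) hd
  · have := le_projConst hC hδ hc (N - 1)
    linarith
  · exact ⟨t₀, hIΩ 0 hN t₀ ht₀, by simp⟩
  · rw [hA]
    exact hproj _ (by omega)

/-- A domain containing all nonreal points. -/
structure IsSlitPlane (Ω : Set ℂ) : Prop where
  isOpen : IsOpen Ω
  isConnected : IsConnected Ω
  mem_of_im_ne_zero : ∀ z : ℂ, z.im ≠ 0 → z ∈ Ω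

theorem IsDenjoyDomain.isSlitPlane {Ω : Set ℂ} (h : IsDenjoyDomain Ω) {t : ℝ}
    (ht : (t : ℂ) ∈ Ω) : IsSlitPlane Ω := by
  obtain ⟨ho, hc, hf⟩ := h
  obtain ⟨r, hr, hb⟩ := Metric.isOpen_iff.1 ho t ht
  have key : ∀ H : Set ℂ, Convex ℝ H → (∀ z ∈ H, z.im ≠ 0) → (H ∩ Ω).Nonempty → H ⊆ Ω := by
    intro H hH hne hi
    refine hH.isPreconnected.subset_of_closure_inter_subset ho hi fun z hz => ?_
    by_contra hz'
    exact hne z hz.2 (hf (by rw [ho.frontier_eq]; exact ⟨hz.1, hz'⟩))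
  have hmem : ∀ ε : ℝ, |ε| = r / 2 → (t : ℂ) + ε * I ∈ Ω := by
    intro ε hε
    apply hb
    rw [mem_ball, dist_eq_norm, add_sub_cancel_left, norm_mul, norm_I, norm_real,
      Real.norm_eq_abs, hε]
    linarith
  refine ⟨ho, hc, fun z hz => ?_⟩
  rcases lt_or_gt_of_ne hz with hz | hz
  · refine key {z | z.im < 0} (convex_halfSpace_im_lt 0) (fun z hz => ne_of_lt hz)
      ⟨_, ?_, hmem (-(r / 2)) ?_⟩ hz
    · simpa using hr
    · rw [abs_neg, abs_of_pos (half_pos hr)]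
  · refine key {z | 0 < z.im} (convex_halfSpace_im_gt 0) (fun z hz => ne_of_gt hz)
      ⟨_, ?_, hmem (r / 2) ?_⟩ hz
    · simpa using hr
    · rw [abs_of_pos (half_pos hr)]

theorem IsSlitPlane.conj_mem {Ω : Set ℂ} (h : IsSlitPlane Ω) {z : ℂ} (hz : z ∈ Ω) :
    (starRingEnd ℂ) z ∈ Ω := by
  by_cases h0 : z.im = 0
  · rwa [conj_eq_iff_im.2 h0]
  · exact h.mem_of_im_ne_zero _ (by simpa using h0)

theorem IsSlitPlane.im_eq_zero {Ω : Set ℂ} (h : IsSlitPlane Ω) {z : ℂ} (hz : z ∈ Ωᶜ) :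
    z.im = 0 := by
  by_contra h0
  exact hz (h.mem_of_im_ne_zero z h0)

/-- The part of `Ω` in the closed upper half-plane. -/
def upperPart (Ω : Set ℂ) : Set ℂ := {z | z ∈ Ω ∧ 0 ≤ z.im}

theorem IsSlitPlane.add_mem_upperPart {Ω : Set ℂ} (h : IsSlitPlane Ω) {x : ℂ}
    (hx : x ∈ upperPart Ω) {t : ℝ} (ht : 0 ≤ t) : x + t * I ∈ upperPart Ω := by
  have him : (x + t * I).im = x.im + t := by simp
  refine ⟨?_, by rw [him]; exact add_nonneg hx.2 ht⟩
  rcases ht.eq_or_lt with rfl | ht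
  · simpa using hx.1
  · exact h.mem_of_im_ne_zero _ (by rw [him]; linarith [hx.2])

section

variable {Ω : Set ℂ} {x y : ℂ}

theorem IsSlitPlane.infDist_pos (h : IsSlitPlane Ω) (hne : Ωᶜ.Nonempty) (hx : x ∈ Ω) :
    0 < infDist x Ωᶜ :=
  (h.isOpen.isClosed_compl.notMem_iff_infDist_pos hne).1 (by simpa using hx)

theorem IsSlitPlane.infDist_add_ge (h : IsSlitPlane Ω) (hne : Ωᶜ.Nonempty)
    (hx : 0 ≤ x.im) {t : ℝ} (ht : 0 ≤ t) :
    infDist x Ωᶜ ≤ infDist (x + t * I) Ωᶜ ∧ t ≤ infDist (x + t * I) Ωᶜ := by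
  constructor
  · refine (le_infDist hne).2 fun e he => (infDist_le_dist_of_mem he).trans ?_
    have h0 := h.im_eq_zero he
    rw [dist_eq, dist_eq, norm_def, norm_def]
    apply Real.sqrt_le_sqrt
    simp only [normSq_apply, sub_re, sub_im, add_re, add_im, mul_re, mul_im, ofReal_re, ofReal_im,
      I_re, I_im, h0]
    nlinarith
  · refine (le_infDist hne).2 fun e he => ?_
    have h0 := h.im_eq_zero he
    rw [dist_eq]
    refine le_trans ?_ (abs_im_le_norm _)
    refine le_trans ?_ (le_abs_self _)
    simp [h0, hx]

theorem IsSlitPlane.infDist_conj (h : IsSlitPlane Ω) (z : ℂ) :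
    infDist ((starRingEnd ℂ) z) Ωᶜ = infDist z Ωᶜ := by
  have himg : (starRingEnd ℂ) '' Ωᶜ = Ωᶜ := by
    have : ∀ e ∈ Ωᶜ, (starRingEnd ℂ) e = e := fun e he => conj_eq_iff_im.2 (h.im_eq_zero he)
    rw [image_congr this, image_id']
  conv_lhs => rw [← himg]
  exact infDist_image isometry_conj

theorem IsSlitPlane.infDist_upperFold (h : IsSlitPlane Ω) (z : ℂ) :
    infDist (upperFold z) Ωᶜ = infDist z Ωᶜ := by
  unfold upperFold
  split_ifs
  exacts [rfl, h.infDist_conj z]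

theorem IsSlitPlane.isSymmDensityOn_qhDensity (h : IsSlitPlane Ω) (hne : Ωᶜ.Nonempty) :
    IsSymmDensityOn Ω (qhDensity Ω) where
  isOpen := h.isOpen
  isConnected := h.isConnected
  continuousOn := (continuous_infDist_pt _).continuousOn.inv₀ fun _ hz =>
    (h.infDist_pos hne hz).ne'
  nonneg _ _ := inv_nonneg.2 infDist_nonneg
  conj_mem _ hz := h.conj_mem hz
  map_conj z _ := by simp only [qhDensity, h.infDist_conj]

theorem norm_upperFold_sub_le (z w : ℂ) : ‖upperFold z - upperFold w‖ ≤ ‖z - w‖ := by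
  rw [upperFold_eq, upperFold_eq, norm_def, norm_def]
  apply Real.sqrt_le_sqrt
  simp only [normSq_apply, sub_re, sub_im]
  have := abs_abs_sub_abs_le_abs_sub z.im w.im
  have h2 := sq_le_sq.2 this
  nlinarith

theorem IsSlitPlane.isPseudoDistOn_qhDist (h : IsSlitPlane Ω) (hne : Ωᶜ.Nonempty) :
    IsPseudoDistOn (upperPart Ω) (qhDist Ω) :=
  (h.isSymmDensityOn_qhDensity hne).isPseudoDistOn.mono fun _ hz => hz.1

/-- Upper bound for the quasihyperbolic length of a vertical segment. -/
theorem IsSlitPlane.qhDist_vertical_le (h : IsSlitPlane Ω) (hne : Ωᶜ.Nonempty)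
    (hx : x ∈ upperPart Ω) {r : ℝ} (hr : 0 ≤ r) :
    qhDist Ω x (x + r * I) ≤ 2 * Real.log (1 + r / infDist x Ωᶜ) := by
  set δ := infDist x Ωᶜ with hδ
  have hδ0 : 0 < δ := h.infDist_pos hne hx.1
  have hρ := (h.isSymmDensityOn_qhDensity hne).toIsDensityOn
  have hseg : segment ℝ x (x + r * I) ⊆ Ω := by
    rw [segment_eq_image']
    rintro _ ⟨t, ht, rfl⟩
    have := h.add_mem_upperPart hx (mul_nonneg ht.1 hr)
    simpa [mul_assoc] using this.1
  refine ((isCurveIn_segment hseg).densityDist_le_sub hρ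
    (B := fun t => 2 * Real.log (δ + t * r)) (B' := fun t => 2 * (r / (δ + t * r))) ?_ ?_).trans ?_
  · intro t ht
    have hpos : δ + t * r ≠ 0 := (add_pos_of_pos_of_nonneg hδ0 (mul_nonneg ht.1 hr)).ne'
    have h1 : HasDerivAt (fun t : ℝ => δ + t * r) r t := by
      simpa using ((hasDerivAt_id t).mul_const r).const_add δ
    exact (h1.log hpos).const_mul 2
  · intro t ht
    have htr : 0 ≤ t * r := mul_nonneg ht.1.le hr
    obtain ⟨h1, h2⟩ := h.infDist_add_ge hne hx.2 htr
    rw [deriv_segment, add_sub_cancel_left, norm_mul, norm_I, norm_real, Real.norm_eq_abs,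
      abs_of_nonneg hr, mul_one, qhDensity]
    have he : x + (t : ℂ) * (r * I) = x + ((t * r : ℝ) : ℂ) * I := by push_cast; ring
    rw [he, inv_mul_eq_div]
    have h3 : (δ + t * r) / 2 ≤ infDist (x + ((t * r : ℝ) : ℂ) * I) Ωᶜ := by linarith
    calc r / infDist (x + ((t * r : ℝ) : ℂ) * I) Ωᶜ ≤ r / ((δ + t * r) / 2) :=
          div_le_div_of_nonneg_left hr (by positivity) h3
      _ = 2 * (r / (δ + t * r)) := by field_simp
  · have : 1 + r / δ = (δ + r) / δ := by field_simp
    rw [this, Real.log_div (by positivity) hδ0.ne']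
    simp only [one_mul, zero_mul, add_zero]
    linarith

/-- Upper bound for the quasihyperbolic distance of two points lifted by their distance. -/
theorem IsSlitPlane.qhDist_horizontal_le (h : IsSlitPlane Ω) (hne : Ωᶜ.Nonempty)
    (hx : x ∈ upperPart Ω) (hy : y ∈ upperPart Ω) {r : ℝ} (hr : 0 < r) (hxy : ‖x - y‖ ≤ r) :
    qhDist Ω (x + r * I) (y + r * I) ≤ 1 := by
  have hρ := (h.isSymmDensityOn_qhDensity hne).toIsDensityOn
  have hpt : ∀ u ∈ segment ℝ (x + r * I) (y + r * I), ∃ v : ℂ, 0 ≤ v.im ∧ u = v + r * I := by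
    intro u hu
    have hsub : segment ℝ (x + r * I) (y + r * I) ⊆ {u : ℂ | r ≤ u.im} :=
      (convex_halfSpace_im_ge r).segment_subset (by simpa using hx.2) (by simpa using hy.2)
    exact ⟨u - r * I, by simpa using hsub hu, by ring⟩
  have hle : densityDist Ω (qhDensity Ω) (x + r * I) (y + r * I) ≤
      r⁻¹ * ‖(y + r * I) - (x + r * I)‖ := by
    refine hρ.densityDist_le_of_segment ?_ ?_
    · intro u hu
      obtain ⟨v, hv, rfl⟩ := hpt u hu
      refine h.mem_of_im_ne_zero _ ?_
      have : (v + r * I).im = v.im + r := by simp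
      rw [this]
      linarith
    · intro u hu
      obtain ⟨v, hv, rfl⟩ := hpt u hu
      exact inv_anti₀ hr (h.infDist_add_ge hne hv hr.le).2
  refine hle.trans ?_
  rw [add_sub_add_right_eq_sub, norm_sub_rev, inv_mul_le_one₀ hr]
  exact hxy

theorem IsSlitPlane.qhDist_le (h : IsSlitPlane Ω) (hne : Ωᶜ.Nonempty)
    (hx : x ∈ upperPart Ω) (hy : y ∈ upperPart Ω) {r : ℝ} (hr : 0 < r) (hxy : ‖x - y‖ ≤ r) :
    qhDist Ω x y ≤ qhDist Ω x (x + r * I) + 1 + qhDist Ω y (y + r * I) := by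
  have hd := h.isPseudoDistOn_qhDist hne
  have hx' := h.add_mem_upperPart hx hr.le
  have hy' := h.add_mem_upperPart hy hr.le
  have h1 := hd.triangle x hx _ hx' y hy
  have h2 := hd.triangle _ hx' _ hy' y hy
  have h3 := h.qhDist_horizontal_le hne hx hy hr hxy
  rw [hd.symm _ hy' y hy] at h2
  linarith

end

/-- The arc length function of a curve. -/
theorem IsCurveIn.exists_lengthFunction {Ω : Set ℂ} {ρ : ℂ → ℝ} {γ : ℝ → ℂ} {z w : ℂ}
    (hγ : IsCurveIn Ω γ z w) (hρ : IsDensityOn Ω ρ) :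
    ∃ ℓ : ℝ → ℝ, (∀ t ∈ Icc (0 : ℝ) 1, HasDerivAt ℓ (curveSpeed ρ γ t) t) ∧
      ∀ a ∈ Icc (0 : ℝ) 1, ∀ b ∈ Icc (0 : ℝ) 1, ∫ t in a..b, curveSpeed ρ γ t = ℓ b - ℓ a := by
  set g : ℝ → ℝ := IccExtend zero_le_one ((Icc (0 : ℝ) 1).domRestrict (curveSpeed ρ γ)) with hg
  have hgc : Continuous g :=
    (hγ.continuousOn_curveSpeed hρ.continuousOn).domRestrict.Icc_extend'
  have hge : ∀ t ∈ Icc (0 : ℝ) 1, g t = curveSpeed ρ γ t := fun t ht => by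
    rw [hg, IccExtend_of_mem _ _ ht, domRestrict_apply]
  refine ⟨fun t => ∫ s in (0 : ℝ)..t, g s, fun t ht => ?_, fun a ha b hb => ?_⟩
  · rw [← hge t ht]
    exact intervalIntegral.integral_hasDerivAt_right (hgc.intervalIntegrable _ _)
      (hgc.stronglyMeasurableAtFilter _ _) hgc.continuousAt
  · rw [intervalIntegral.integral_interval_sub_left (hgc.intervalIntegrable _ _)
      (hgc.intervalIntegrable _ _)]
    exact intervalIntegral.integral_congr fun t ht => (hge t (uIcc_subset_Icc ha hb ht)).symm

section

variable {Ω : Set ℂ} {γ : ℝ → ℂ} {x y : ℂ}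

/-- Subarcs of an almost minimizing curve are almost minimizing, even after folding. -/
theorem IsSymmDensityOn.integral_curveSpeed_le {ρ : ℂ → ℝ} (h : IsSymmDensityOn Ω ρ)
    (hx : x ∈ upperPart Ω) (hy : y ∈ upperPart Ω) (hγ : IsCurveIn Ω γ x y)
    (hlen : curveLen ρ γ < densityDist Ω ρ x y + 1) {a b : ℝ} (ha : 0 ≤ a) (hab : a ≤ b)
    (hb : b ≤ 1) :
    ∫ t in a..b, curveSpeed ρ γ t ≤
      densityDist Ω ρ (upperFold (γ a)) (upperFold (γ b)) + 1 := by
  have hd := h.isPseudoDistOn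
  have hρ := h.toIsDensityOn
  have ma : a ∈ Icc (0 : ℝ) 1 := ⟨ha, hab.trans hb⟩
  have mb : b ∈ Icc (0 : ℝ) 1 := ⟨ha.trans hab, hb⟩
  have m0 : (0 : ℝ) ∈ Icc (0 : ℝ) 1 := ⟨le_rfl, zero_le_one⟩
  have m1 : (1 : ℝ) ∈ Icc (0 : ℝ) 1 := ⟨zero_le_one, le_rfl⟩
  have hγa := hγ.mapsTo a ma
  have hγb := hγ.mapsTo b mb
  have h1 := intervalIntegral.integral_add_adjacent_intervals
    (hγ.intervalIntegrable hρ m0 ma) (hγ.intervalIntegrable hρ ma mb)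
  have h2 := intervalIntegral.integral_add_adjacent_intervals
    (hγ.intervalIntegrable hρ m0 mb) (hγ.intervalIntegrable hρ mb m1)
  rw [← curveLen_eq_integral_curveSpeed] at h2
  have h3 := hγ.densityDist_le_integral hρ le_rfl ha ma.2
  have h4 := hγ.densityDist_le_integral hρ mb.1 hb le_rfl
  rw [hγ.source] at h3
  rw [hγ.target] at h4
  have h5 := h.densityDist_upperFold_le hx.1 hγa
  have h6 := h.densityDist_upperFold_le hγb hy.1
  rw [upperFold_of_nonneg hx.2] at h5
  rw [upperFold_of_nonneg hy.2] at h6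
  have h7 := hd.triangle x hx.1 _ (h.upperFold_mem hγa) y hy.1
  have h8 := hd.triangle _ (h.upperFold_mem hγa) _ (h.upperFold_mem hγb) y hy.1
  linarith

/-- An almost minimizing quasihyperbolic curve cannot go far while staying as close to the
boundary as it is at the start. -/
theorem IsSlitPlane.norm_sub_le_of_infDist_le (h : IsSlitPlane Ω) (hne : Ωᶜ.Nonempty)
    (hx : x ∈ upperPart Ω) (hy : y ∈ upperPart Ω) (hγ : IsCurveIn Ω γ x y)
    (hlen : curveLen (qhDensity Ω) γ < qhDist Ω x y + 1) {a b : ℝ} (ha : 0 ≤ a) (hab : a ≤ b)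
    (hb : b ≤ 1) (hM : ∀ t ∈ Icc a b, infDist (γ t) Ωᶜ ≤ infDist (γ a) Ωᶜ) :
    ‖γ b - γ a‖ ≤ 256 * infDist (γ a) Ωᶜ := by
  have hs := h.isSymmDensityOn_qhDensity hne
  have hsub : Icc a b ⊆ Icc (0 : ℝ) 1 := Icc_subset_Icc ha hb
  have hpos : ∀ t ∈ Icc a b, 0 < infDist (γ t) Ωᶜ := fun t ht =>
    h.infDist_pos hne (hγ.mapsTo t (hsub ht))
  have maa : a ∈ Icc a b := ⟨le_rfl, hab⟩
  set M := infDist (γ a) Ωᶜ with hMdef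
  have hM0 : 0 < M := hpos a maa
  have hcont : ContinuousOn (fun t => ‖γ t - γ a‖) (Icc a b) :=
    ((hγ.continuousOn.mono hsub).sub continuousOn_const).norm
  obtain ⟨c, hc, hmax⟩ := isCompact_Icc.exists_isMaxOn ⟨a, maa⟩ hcont
  set D := ‖γ c - γ a‖ with hD
  have hbD : ‖γ b - γ a‖ ≤ D := hmax ⟨hab, le_rfl⟩
  refine hbD.trans ?_
  rcases le_or_gt D M with hDM | hDM
  · linarith
  have hD0 : 0 < D := hM0.trans hDM
  obtain ⟨ℓ, hℓ', hℓ⟩ := hγ.exists_lengthFunction hs.toIsDensityOn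
  set A := 2 * √(D * M) with hA
  have hA0 : 0 < A := by positivity
  have hA2 : A ^ 2 = 4 * (D * M) := by
    rw [hA, mul_pow, Real.sq_sqrt (by positivity)]
    norm_num
  have key : ∀ t ∈ Icc a c, infDist (γ t) Ωᶜ ≤ A * Real.exp (-((ℓ t - ℓ a) / 8)) := by
    intro t ht
    have ht' : t ∈ Icc a b := ⟨ht.1, ht.2.trans hc.2⟩
    set δ := infDist (γ t) Ωᶜ with hδ
    have hδ0 : 0 < δ := hpos t ht'
    have hδM : δ ≤ M := hM t ht'
    have hFa : upperFold (γ a) ∈ upperPart Ω :=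
      ⟨hs.upperFold_mem (hγ.mapsTo a (hsub maa)), upperFold_im_nonneg _⟩
    have hFt : upperFold (γ t) ∈ upperPart Ω :=
      ⟨hs.upperFold_mem (hγ.mapsTo t (hsub ht')), upperFold_im_nonneg _⟩
    have hdist : ‖upperFold (γ a) - upperFold (γ t)‖ ≤ D := by
      refine (norm_upperFold_sub_le _ _).trans ?_
      rw [norm_sub_rev]
      exact hmax ht'
    have h1 := hs.integral_curveSpeed_le hx hy hγ hlen ha ht.1 (hsub ht').2
    have h2 := h.qhDist_le hne hFa hFt hD0 hdist
    have h3 := h.qhDist_vertical_le hne hFa hD0.le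
    have h4 := h.qhDist_vertical_le hne hFt hD0.le
    rw [h.infDist_upperFold, ← hMdef] at h3
    rw [h.infDist_upperFold, ← hδ] at h4
    rw [hℓ a (hsub maa) t (hsub ht')] at h1
    rw [qhDist] at h2 h3 h4
    have h5 : (ℓ t - ℓ a) / 2 ≤ 1 + Real.log (1 + D / M) + Real.log (1 + D / δ) := by
      linarith
    have h6 := Real.exp_le_exp.2 h5
    rw [Real.exp_add, Real.exp_add, Real.exp_log (by positivity), Real.exp_log (by positivity)]
      at h6
    have e1 : Real.exp 1 ≤ 4 := by linarith [Real.exp_one_lt_d9]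
    have e2 : 1 + D / M ≤ 2 * D / M := by
      rw [le_div_iff₀ hM0, add_mul, div_mul_cancel₀ _ hM0.ne']
      linarith
    have e3 : 1 + D / δ ≤ 2 * D / δ := by
      rw [le_div_iff₀ hδ0, add_mul, div_mul_cancel₀ _ hδ0.ne']
      linarith
    have h7 : Real.exp ((ℓ t - ℓ a) / 2) ≤ 4 * (2 * D / M) * (2 * D / δ) :=
      h6.trans (by gcongr)
    have h8 : Real.exp ((ℓ t - ℓ a) / 2) * (M * δ) ≤ 16 * D ^ 2 := by
      calc _ ≤ 4 * (2 * D / M) * (2 * D / δ) * (M * δ) := by gcongr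
        _ = 16 * D ^ 2 := by field_simp; ring
    have h9 : (δ * Real.exp ((ℓ t - ℓ a) / 8)) ^ 4 ≤ A ^ 4 := by
      have e4 : Real.exp ((ℓ t - ℓ a) / 8) ^ 4 = Real.exp ((ℓ t - ℓ a) / 2) := by
        rw [← Real.exp_nat_mul]
        congr 1
        push_cast
        ring
      have e5 : δ ^ 2 ≤ M ^ 2 := pow_le_pow_left₀ hδ0.le hδM 2
      calc (δ * Real.exp ((ℓ t - ℓ a) / 8)) ^ 4
          = Real.exp ((ℓ t - ℓ a) / 2) * (δ * δ) * δ ^ 2 := by rw [mul_pow, e4]; ring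
        _ ≤ Real.exp ((ℓ t - ℓ a) / 2) * (M * δ) * M ^ 2 := by gcongr
        _ ≤ 16 * D ^ 2 * M ^ 2 := by gcongr
        _ = A ^ 4 := by
          rw [show A ^ 4 = (A ^ 2) ^ 2 by ring, hA2]
          ring
    have h10 := le_of_pow_le_pow_left₀ (by norm_num) hA0.le h9
    rw [Real.exp_neg, ← div_eq_mul_inv, le_div_iff₀ (Real.exp_pos _)]
    exact h10
  have hbound := image_norm_le_of_norm_deriv_right_le_deriv_boundary' (a := a) (b := c)
    (f := fun t => γ t - γ a) (f' := fun t => derivWithin γ (Icc 0 1) t)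
    (B := fun t => 8 * A * (1 - Real.exp (-((ℓ t - ℓ a) / 8))))
    (B' := fun t => A * Real.exp (-((ℓ t - ℓ a) / 8)) * curveSpeed (qhDensity Ω) γ t)
    ((hγ.continuousOn.mono (Icc_subset_Icc ha (hc.2.trans hb))).sub continuousOn_const)
    ?_ (by simp) ?_ ?_ ?_ (right_mem_Icc.2 hc.1)
  · have h1 : D ≤ 8 * A := by
      refine hbound.trans ?_
      have := Real.exp_pos (-((ℓ c - ℓ a) / 8))
      nlinarith
    have h2 : D ^ 2 ≤ 256 * M * D := by
      calc D ^ 2 ≤ (8 * A) ^ 2 := pow_le_pow_left₀ hD0.le h1 2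
        _ = 256 * M * D := by rw [mul_pow, hA2]; ring
    nlinarith
  · intro t ht
    have ht01 : t ∈ Icc (0 : ℝ) 1 := ⟨ha.trans ht.1, (ht.2.le.trans hc.2).trans hb⟩
    have h1 : HasDerivWithinAt γ (derivWithin γ (Icc 0 1) t) (Ici t) t :=
      ((hγ.hasDerivWithinAt ht01).mono (Icc_subset_Icc_left ht01.1)).mono_of_mem_nhdsWithin
        (Icc_mem_nhdsGE (ht.2.trans_le (hc.2.trans hb)))
    exact h1.sub_const _
  · intro t ht
    have ht01 : t ∈ Icc (0 : ℝ) 1 := ⟨ha.trans ht.1, (ht.2.trans hc.2).trans hb⟩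
    have := (hℓ' t ht01).continuousAt
    exact ContinuousAt.continuousWithinAt (by fun_prop)
  · intro t ht
    have ht01 : t ∈ Icc (0 : ℝ) 1 := ⟨ha.trans ht.1, (ht.2.le.trans hc.2).trans hb⟩
    have h1 := (((((hℓ' t ht01).sub_const (ℓ a)).div_const 8).neg.exp).const_sub 1).const_mul
      (8 * A)
    refine (h1.congr_deriv ?_).hasDerivWithinAt
    simp only [Pi.neg_apply]
    ring
  · intro t ht
    have ht01 : t ∈ Icc (0 : ℝ) 1 := ⟨ha.trans ht.1, (ht.2.le.trans hc.2).trans hb⟩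
    have hp := hpos t ⟨ht.1, ht.2.le.trans hc.2⟩
    have h1 := key t ⟨ht.1, ht.2.le⟩
    calc ‖derivWithin γ (Icc 0 1) t‖
        = infDist (γ t) Ωᶜ * curveSpeed (qhDensity Ω) γ t := by
          rw [curveSpeed, qhDensity, mul_inv_cancel_left₀ hp.ne']
      _ ≤ _ := by
          gcongr
          exact hγ.curveSpeed_nonneg hs.toIsDensityOn ht01

/-- Almost minimizing quasihyperbolic curves starting at `x` pass near the point above `x`, at
every scale up to the distance of the endpoints. -/
theorem IsSlitPlane.exists_near_add (h : IsSlitPlane Ω) (hne : Ωᶜ.Nonempty)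
    (hx : x ∈ upperPart Ω) (hy : y ∈ upperPart Ω) {s : ℝ} (hs0 : 0 < s) (hs : s ≤ ‖x - y‖) :
    ∃ q ∈ upperPart Ω, qhDist Ω x q + qhDist Ω q y ≤ qhDist Ω x y + 1 ∧
      qhDist Ω q (x + s * I) ≤ 15 := by
  have hsym := h.isSymmDensityOn_qhDensity hne
  have hρ := hsym.toIsDensityOn
  have hd := hsym.isPseudoDistOn
  have hdX := h.isPseudoDistOn_qhDist hne
  obtain ⟨γ, hγ, hlen⟩ := hρ.exists_curveLen_lt hx.1 hy.1 zero_lt_one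
  have hcont : ContinuousOn (fun t => ‖γ t - x‖) (Icc 0 1) :=
    (hγ.continuousOn.sub continuousOn_const).norm
  set S := Icc (0 : ℝ) 1 ∩ (fun t => ‖γ t - x‖) ⁻¹' {s} with hS
  have hScl : IsCompact S :=
    isCompact_Icc.of_isClosed_subset (hcont.preimage_isClosed_of_isClosed isClosed_Icc
      isClosed_singleton) inter_subset_left
  have hSne : S.Nonempty := by
    obtain ⟨t, ht, hts⟩ := intermediate_value_Icc zero_le_one hcont
      (show s ∈ Icc _ _ from
        ⟨by simpa [hγ.source] using hs0.le, by simpa [hγ.target, norm_sub_rev] using hs⟩)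
    exact ⟨t, ht, hts⟩
  obtain ⟨T, ⟨hT, hTs⟩, hTmin⟩ := hScl.exists_isLeast hSne
  have hlt : ∀ t ∈ Icc 0 T, ‖γ t - x‖ ≤ s := by
    intro t ht
    by_contra hts
    obtain ⟨u, hu, hus⟩ := intermediate_value_Icc ht.1
      (hcont.mono (Icc_subset_Icc_right (ht.2.trans hT.2)))
      (show s ∈ Icc _ _ from ⟨by simpa [hγ.source] using hs0.le, (not_le.1 hts).le⟩)
    have hu' : T ≤ u := hTmin ⟨⟨hu.1, hu.2.trans (ht.2.trans hT.2)⟩, hus⟩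
    have : u = t := le_antisymm hu.2 (ht.2.trans hu')
    rw [this] at hus
    exact hts hus.le
  obtain ⟨c, hc, hmax⟩ := isCompact_Icc.exists_isMaxOn (s := Icc 0 T) ⟨0, le_rfl, hT.1⟩
    ((continuous_infDist_pt Ωᶜ).comp_continuousOn
      (hγ.continuousOn.mono (Icc_subset_Icc_right hT.2)))
  have hc01 : c ∈ Icc (0 : ℝ) 1 := ⟨hc.1, hc.2.trans hT.2⟩
  have h1 : ‖γ T - γ c‖ ≤ 256 * infDist (γ c) Ωᶜ :=
    h.norm_sub_le_of_infDist_le hne hx hy hγ hlen hc.1 hc.2 hT.2 fun t ht =>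
      hmax ⟨hc.1.trans ht.1, ht.2⟩
  have h2 : ‖γ 0 - γ c‖ ≤ 256 * infDist (γ c) Ωᶜ := by
    have hlen' : curveLen (qhDensity Ω) (fun t => γ (1 - t)) < qhDist Ω y x + 1 := by
      rw [curveLen_reverse, hdX.symm y hy x hx]
      exact hlen
    have := h.norm_sub_le_of_infDist_le hne hy hx hγ.reverse hlen' (a := 1 - c) (b := 1)
      (by linarith [hc01.2]) (by linarith [hc.1]) le_rfl fun t ht => by
        simp only [sub_sub_cancel]
        exact hmax ⟨by linarith [ht.2], by linarith [ht.1, hc.2]⟩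
    simpa using this
  have hγc := hγ.mapsTo c hc01
  have hq : upperFold (γ c) ∈ upperPart Ω := ⟨hsym.upperFold_mem hγc, upperFold_im_nonneg _⟩
  have hδ0 : 0 < infDist (γ c) Ωᶜ := h.infDist_pos hne hγc
  have hsM : s ≤ 512 * infDist (γ c) Ωᶜ := by
    rw [hγ.source] at h2
    have h3 := norm_sub_le_norm_sub_add_norm_sub (γ T) (γ c) x
    rw [norm_sub_rev (γ c) x] at h3
    have h4 : ‖γ T - x‖ = s := hTs
    linarith
  refine ⟨upperFold (γ c), hq, ?_, ?_⟩
  · have h3 := hγ.densityDist_le_integral hρ le_rfl hc01.1 hc01.2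
    have h4 := hγ.densityDist_le_integral hρ hc01.1 hc01.2 le_rfl
    have h5 := intervalIntegral.integral_add_adjacent_intervals
      (hγ.intervalIntegrable hρ ⟨le_rfl, zero_le_one⟩ hc01)
      (hγ.intervalIntegrable hρ hc01 ⟨zero_le_one, le_rfl⟩)
    rw [← curveLen_eq_integral_curveSpeed] at h5
    have h6 := hsym.densityDist_upperFold_le hx.1 hγc
    have h7 := hsym.densityDist_upperFold_le hγc hy.1
    rw [upperFold_of_nonneg hx.2] at h6
    rw [upperFold_of_nonneg hy.2] at h7
    rw [hγ.source] at h3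
    rw [hγ.target] at h4
    rw [qhDist]
    linarith
  · have hqx : ‖upperFold (γ c) - x‖ ≤ s := by
      have := norm_upperFold_sub_le (γ c) x
      rw [upperFold_of_nonneg hx.2] at this
      exact this.trans (hlt c hc)
    have h3 := h.qhDist_vertical_le hne hq hs0.le
    have h4 := h.qhDist_horizontal_le hne hq hx hs0 hqx
    have h5 := hdX.triangle _ hq _ (h.add_mem_upperPart hq hs0.le) _
      (h.add_mem_upperPart hx hs0.le)
    rw [h.infDist_upperFold] at h3
    have h6 : 1 + s / infDist (γ c) Ωᶜ ≤ Real.exp 7 := by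
      have e1 : s / infDist (γ c) Ωᶜ ≤ 512 := by rwa [div_le_iff₀ hδ0]
      have e2 : Real.exp 7 = Real.exp 1 ^ 7 := by
        rw [← Real.exp_nat_mul]
        norm_num
      have e3 : (2.7 : ℝ) ^ 7 ≤ Real.exp 1 ^ 7 :=
        pow_le_pow_left₀ (by norm_num) (by linarith [Real.exp_one_gt_d9]) 7
      rw [e2]
      refine le_trans ?_ e3
      norm_num
      linarith
    have h7 : Real.log (1 + s / infDist (γ c) Ωᶜ) ≤ 7 :=
      (Real.log_le_iff_le_exp (by positivity)).2 h6
    linarith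

end

section

variable {Ω : Set ℂ} {x y z : ℂ}

/-- Coarsely, a quasihyperbolic geodesic between `x` and `y` passes through the points above `x`
at height at most `‖x - y‖`. -/
theorem IsSlitPlane.qhDist_add_le (h : IsSlitPlane Ω) (hne : Ωᶜ.Nonempty)
    (hx : x ∈ upperPart Ω) (hy : y ∈ upperPart Ω) {s : ℝ} (hs0 : 0 < s) (hs : s ≤ ‖x - y‖) :
    qhDist Ω x (x + s * I) + qhDist Ω (x + s * I) y ≤ qhDist Ω x y + 31 := by
  have hd := h.isPseudoDistOn_qhDist hne
  have hx' := h.add_mem_upperPart hx hs0.le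
  obtain ⟨q, hq, h1, h2⟩ := h.exists_near_add hne hx hy hs0 hs
  have h3 := hd.triangle x hx q hq _ hx'
  have h4 := hd.triangle _ hx' q hq y hy
  rw [hd.symm _ hx' q hq] at h4
  linarith

theorem IsSlitPlane.qhDist_vertical_le_div (h : IsSlitPlane Ω) (hne : Ωᶜ.Nonempty)
    (hx : x ∈ upperPart Ω) {s t : ℝ} (hs : 0 < s) (hst : s ≤ t) :
    qhDist Ω (x + s * I) (x + t * I) ≤ 2 * ((t - s) / s) := by
  have hx' := h.add_mem_upperPart hx hs.le
  have h1 := h.qhDist_vertical_le hne hx' (sub_nonneg.2 hst)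
  have h2 := (h.infDist_add_ge hne hx.2 hs.le).2
  have he : x + s * I + ((t - s : ℝ) : ℂ) * I = x + t * I := by push_cast; ring
  have hu : 0 ≤ (t - s) / infDist (x + s * I) Ωᶜ := div_nonneg (sub_nonneg.2 hst) infDist_nonneg
  have h3 := Real.log_le_sub_one_of_pos (x := 1 + (t - s) / infDist (x + s * I) Ωᶜ) (by linarith)
  have h4 : (t - s) / infDist (x + s * I) Ωᶜ ≤ (t - s) / s :=
    div_le_div_of_nonneg_left (sub_nonneg.2 hst) hs h2
  rw [he] at h1
  linarith

theorem IsSlitPlane.qhDist_up_add_up_le (h : IsSlitPlane Ω) (hne : Ωᶜ.Nonempty)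
    (hx : x ∈ upperPart Ω) {s t : ℝ} (hs : 0 < s) (hst : s ≤ t) :
    qhDist Ω x (x + s * I) + qhDist Ω (x + s * I) (x + t * I) ≤
      qhDist Ω x (x + t * I) + 31 := by
  refine h.qhDist_add_le hne hx (h.add_mem_upperPart hx (hs.le.trans hst)) hs ?_
  rw [sub_add_cancel_left, norm_neg, norm_mul, norm_I, norm_real, Real.norm_eq_abs, mul_one]
  exact hst.trans (le_abs_self t)

/-- Lower bound for the quasihyperbolic distance. -/
theorem IsSlitPlane.up_add_up_le_qhDist (h : IsSlitPlane Ω) (hne : Ωᶜ.Nonempty)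
    (hx : x ∈ upperPart Ω) (hy : y ∈ upperPart Ω) (hxy : x ≠ y) :
    qhDist Ω x (x + ‖x - y‖ * I) + qhDist Ω y (y + ‖x - y‖ * I) ≤ qhDist Ω x y + 74 := by
  have hd := h.isPseudoDistOn_qhDist hne
  set r := ‖x - y‖ with hr
  have hr0 : 0 < r := norm_pos_iff.2 (sub_ne_zero.2 hxy)
  set s := r / 4 with hs
  have hs0 : 0 < s := by positivity
  have hsr : s ≤ r := by linarith
  have hxs := h.add_mem_upperPart hx hs0.le
  have hys := h.add_mem_upperPart hy hs0.le
  have hxr := h.add_mem_upperPart hx hr0.le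
  have hyr := h.add_mem_upperPart hy hr0.le
  have h1 := h.qhDist_add_le hne hx hy hs0 hsr
  have h2 : s ≤ ‖y - (x + s * I)‖ := by
    have h3 : r ≤ ‖y - (x + s * I)‖ + ‖(s : ℂ) * I‖ := by
      rw [hr, norm_sub_rev]
      have : y - x = (y - (x + s * I)) + s * I := by ring
      rw [this]
      exact norm_add_le _ _
    rw [norm_mul, norm_I, norm_real, Real.norm_eq_abs, mul_one, abs_of_pos hs0] at h3
    linarith
  have h3 := h.qhDist_add_le hne hy hxs hs0 h2
  have hratio : 2 * ((r - s) / s) = 6 := by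
    rw [hs]
    field_simp
    ring
  have h4 := h.qhDist_vertical_le_div hne hx hs0 hsr
  have h5 := h.qhDist_vertical_le_div hne hy hs0 hsr
  rw [hratio] at h4 h5
  have h6 := hd.triangle x hx _ hxs _ hxr
  have h7 := hd.triangle y hy _ hys _ hyr
  have h8 := hd.nonneg _ hys _ hxs
  rw [hd.symm _ hy _ hxs] at h3
  linarith

/-- The Gromov product of two points is coarsely the distance between the heights `‖x - y‖` and
`R` above `x`. -/
theorem IsSlitPlane.gromovProduct_near (h : IsSlitPlane Ω) (hne : Ωᶜ.Nonempty)
    (hx : x ∈ upperPart Ω) (hy : y ∈ upperPart Ω) (hxy : x ≠ y) {R : ℝ} (hR : ‖x - y‖ ≤ R) :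
    qhDist Ω x (x + R * I) + qhDist Ω y (y + R * I) - qhDist Ω x y ≤
        2 * qhDist Ω (x + ‖x - y‖ * I) (x + R * I) + 76 ∧
      2 * qhDist Ω (x + ‖x - y‖ * I) (x + R * I) ≤
        qhDist Ω x (x + R * I) + qhDist Ω y (y + R * I) - qhDist Ω x y + 65 := by
  have hd := h.isPseudoDistOn_qhDist hne
  have h1 := h.up_add_up_le_qhDist hne hx hy hxy
  have hr0 : 0 < ‖x - y‖ := norm_pos_iff.2 (sub_ne_zero.2 hxy)
  have h2 := h.qhDist_le hne hx hy hr0 le_rfl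
  set r := ‖x - y‖ with hr
  have hxr := h.add_mem_upperPart hx hr0.le
  have hyr := h.add_mem_upperPart hy hr0.le
  have hxR := h.add_mem_upperPart hx (hr0.le.trans hR)
  have hyR := h.add_mem_upperPart hy (hr0.le.trans hR)
  have h3 := h.qhDist_up_add_up_le hne hx hr0 hR
  have h4 := h.qhDist_up_add_up_le hne hy hr0 hR
  have h5 := hd.triangle _ hx _ hxr _ hxR
  have h6 := hd.triangle _ hy _ hyr _ hyR
  have h7 := h.qhDist_horizontal_le hne hx hy hr0 le_rfl
  have h8 := h.qhDist_horizontal_le hne hx hy (hr0.trans_le hR) hR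
  have h9 := hd.triangle _ hxr _ hyr _ hxR
  have h10 := hd.triangle _ hyr _ hyR _ hxR
  have h11 := hd.triangle _ hyr _ hxr _ hyR
  have h12 := hd.triangle _ hxr _ hxR _ hyR
  rw [hd.symm _ hyR _ hxR] at h10
  rw [hd.symm _ hyr _ hxr] at h11
  constructor <;> linarith

theorem IsSlitPlane.gromovProduct_le (h : IsSlitPlane Ω) (hne : Ωᶜ.Nonempty)
    (hx : x ∈ upperPart Ω) (hy : y ∈ upperPart Ω) (hz : z ∈ upperPart Ω) {R : ℝ} (hR0 : 0 < R)
    (hxy : ‖x - y‖ ≤ R) (hxz : ‖x - z‖ ≤ R) (hle : ‖x - y‖ ≤ 2 * ‖x - z‖) :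
    qhDist Ω x (x + R * I) + qhDist Ω z (z + R * I) - qhDist Ω x z ≤
      qhDist Ω x (x + R * I) + qhDist Ω y (y + R * I) - qhDist Ω x y + 203 := by
  have hd := h.isPseudoDistOn_qhDist hne
  have hxR := h.add_mem_upperPart hx hR0.le
  by_cases hne' : x = y
  · subst hne'
    have hzR := h.add_mem_upperPart hz hR0.le
    have h1 := hd.triangle _ hz _ hx _ hzR
    have h2 := hd.triangle _ hx _ hxR _ hzR
    have h3 := h.qhDist_horizontal_le hne hx hz hR0 hxz
    rw [hd.symm _ hz _ hx] at h1
    rw [hd.self x hx]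
    linarith
  · have hr0 : 0 < ‖x - y‖ := norm_pos_iff.2 (sub_ne_zero.2 hne')
    have ht0 : 0 < ‖x - z‖ := by linarith
    have hne'' : x ≠ z := by
      rintro rfl
      simp at ht0
    have h1 := (h.gromovProduct_near hne hx hz hne'' hxz).1
    have h2 := (h.gromovProduct_near hne hx hy hne' hxy).2
    set r := ‖x - y‖ with hr
    set t := ‖x - z‖ with ht
    have hxr := h.add_mem_upperPart hx hr0.le
    have hxt := h.add_mem_upperPart hx ht0.le
    have h3 : qhDist Ω (x + t * I) (x + R * I) ≤ qhDist Ω (x + r * I) (x + R * I) + 31 := by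
      rcases le_total r t with hrt | hrt
      · have he : ∀ u : ℝ, x + r * I + ((u - r : ℝ) : ℂ) * I = x + u * I := fun u => by
          push_cast
          ring
        rcases hrt.eq_or_lt with hrt | hrt
        · rw [hrt]
          linarith
        · have h4 := h.qhDist_up_add_up_le hne hxr (sub_pos.2 hrt)
            (sub_le_sub_right hxz r)
          rw [he, he] at h4
          have := hd.nonneg _ hxr _ hxt
          linarith
      · have h4 := hd.triangle _ hxt _ hxr _ hxR
        have h5 := h.qhDist_vertical_le_div hne hx ht0 hrt
        have h6 : (r - t) / t ≤ 1 := by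
          rw [div_le_one ht0]
          linarith
        linarith
    linarith

/-- The quasihyperbolic metric is hyperbolic on the upper half. -/
theorem IsSlitPlane.fourPointOn_qhDist (h : IsSlitPlane Ω) (hne : Ωᶜ.Nonempty) :
    FourPointOn (upperPart Ω) (qhDist Ω) 406 := by
  have hd := h.isPseudoDistOn_qhDist hne
  intro x hx y hy z hz w hw
  set B := ‖x‖ + ‖y‖ + ‖z‖ + ‖w‖ with hB
  have nx := norm_nonneg x
  have ny := norm_nonneg y
  have nz := norm_nonneg z
  have nw := norm_nonneg w
  set R := 2 * B + 1 with hR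
  have hR0 : 0 < R := by linarith
  have hdist : ∀ u v : ℂ, ‖u‖ ≤ B → ‖v‖ ≤ B → ‖u - v‖ ≤ R := fun u v hu hv => by
    have := norm_sub_le u v
    linarith
  have key := add_le_add_of_min_le (S := {u | u ∈ upperPart Ω ∧ ‖u‖ ≤ B})
    (g := fun u v => qhDist Ω u (u + R * I) + qhDist Ω v (v + R * I) - qhDist Ω u v)
    (C := 203) ?_ ?_ (x := x) (y := y) (z := z) (w := w) ⟨hx, by linarith⟩ ⟨hy, by linarith⟩
    ⟨hz, by linarith⟩ ⟨hw, by linarith⟩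
  · simp only [min_le_iff] at key
    rcases key with key | key
    · have := le_max_left (qhDist Ω x z + qhDist Ω y w) (qhDist Ω x w + qhDist Ω y z)
      linarith
    · have := le_max_right (qhDist Ω x z + qhDist Ω y w) (qhDist Ω x w + qhDist Ω y z)
      linarith
  · rintro u ⟨hu, hu'⟩ v ⟨hv, hv'⟩ q ⟨hq, hq'⟩
    have h1 := norm_sub_le_norm_sub_add_norm_sub u q v
    rcases le_total ‖u - v‖ (2 * ‖u - q‖) with h2 | h2
    · exact (min_le_left _ _).trans
        (h.gromovProduct_le hne hu hv hq hR0 (hdist u v hu' hv') (hdist u q hu' hq') h2)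
    · have h3 : ‖v - u‖ ≤ 2 * ‖v - q‖ := by
        rw [norm_sub_rev v u, norm_sub_rev v q]
        linarith
      have h4 := h.gromovProduct_le hne hv hu hq hR0 (hdist v u hv' hu') (hdist v q hv' hq') h3
      refine (min_le_right _ _).trans ?_
      rw [hd.symm v hv q hq, hd.symm v hv u hu] at h4
      linarith
  · rintro u ⟨hu, -⟩ v ⟨hv, -⟩
    rw [hd.symm u hu v hv]
    ring

/-- Coarse additivity of the quasihyperbolic distance along an interval of the real axis. -/
theorem IsSlitPlane.qhDist_add_le_of_interval (h : IsSlitPlane Ω) (hne : Ωᶜ.Nonempty) {p q a : ℝ}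
    (hpq : p < q) (hqa : q < a) (hJ : ∀ t ∈ Icc p a, (t : ℂ) ∈ Ω) :
    qhDist Ω p q + qhDist Ω q a ≤ qhDist Ω p a + 37 := by
  have hd := h.isPseudoDistOn_qhDist hne
  have hX : ∀ t ∈ Icc p a, (t : ℂ) ∈ upperPart Ω := fun t ht => ⟨hJ t ht, by simp⟩
  have hp := hX p ⟨le_rfl, (hpq.trans hqa).le⟩
  have hq := hX q ⟨hpq.le, hqa.le⟩
  have ha := hX a ⟨(hpq.trans hqa).le, le_rfl⟩
  have hδ : ∀ s : ℝ, s ≤ q - p → s ≤ a - q → s ≤ infDist (q : ℂ) Ωᶜ := by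
    intro s h1 h2
    refine (le_infDist hne).2 fun e he => ?_
    have he0 := h.im_eq_zero he
    have hee : e = (e.re : ℂ) := Complex.ext (by simp) (by simp [he0])
    have hout : e.re ∉ Icc p a := fun hmem => he (by rw [hee]; exact hJ _ hmem)
    rw [hee, dist_eq, ← ofReal_sub, norm_real, Real.norm_eq_abs]
    rw [mem_Icc, not_and_or, not_le, not_le] at hout
    rcases hout with hout | hout
    · exact le_trans (by linarith) (le_abs_self _)
    · exact le_trans (by linarith) (neg_le_abs _)
  have hup : ∀ s : ℝ, 0 < s → s ≤ q - p → s ≤ a - q → qhDist Ω (q : ℂ) (q + s * I) ≤ 2 := by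
    intro s hs h1 h2
    have h3 := hδ s h1 h2
    have h4 := h.qhDist_vertical_le hne hq hs.le
    have h0 : 0 < s / infDist (q : ℂ) Ωᶜ := div_pos hs (hs.trans_le h3)
    have h5 := Real.log_le_sub_one_of_pos (x := 1 + s / infDist (q : ℂ) Ωᶜ) (by linarith)
    have h6 : s / infDist (q : ℂ) Ωᶜ ≤ 1 := by rwa [div_le_one (hs.trans_le h3)]
    linarith
  have hnorm : ∀ u v : ℝ, ‖(u : ℂ) - v‖ = |u - v| := fun u v => by
    rw [← ofReal_sub, norm_real, Real.norm_eq_abs]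
  rcases le_total (q - p) (a - q) with hs | hs
  · have hs0 : 0 < q - p := sub_pos.2 hpq
    have h1 := h.qhDist_add_le hne hp ha hs0
      (by rw [hnorm, abs_sub_comm]; exact le_trans (by linarith) (le_abs_self _))
    have h2 := h.qhDist_horizontal_le hne hp hq hs0 (by rw [hnorm, abs_sub_comm, abs_of_pos hs0])
    have h3 := hup _ hs0 le_rfl hs
    have hp' := h.add_mem_upperPart hp hs0.le
    have hq' := h.add_mem_upperPart hq hs0.le
    have h4 := hd.triangle _ hp _ hp' _ hq
    have h5 := hd.triangle _ hp' _ hq' _ hq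
    have h6 := hd.triangle _ hq _ hp' _ ha
    rw [hd.symm _ hq' _ hq] at h5
    rw [hd.symm _ hq _ hp'] at h6
    linarith
  · have hs0 : 0 < a - q := sub_pos.2 hqa
    have h1 := h.qhDist_add_le hne ha hp hs0
      (by rw [hnorm]; exact le_trans (by linarith) (le_abs_self _))
    have h2 := h.qhDist_horizontal_le hne ha hq hs0 (by rw [hnorm, abs_of_pos hs0])
    have h3 := hup _ hs0 hs le_rfl
    have ha' := h.add_mem_upperPart ha hs0.le
    have hq' := h.add_mem_upperPart hq hs0.le
    have h4 := hd.triangle _ ha _ ha' _ hq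
    have h5 := hd.triangle _ ha' _ hq' _ hq
    have h6 := hd.triangle _ hq _ ha' _ hp
    rw [hd.symm _ hq' _ hq] at h5
    rw [hd.symm _ hq _ ha'] at h6
    rw [hd.symm _ hp _ hq, hd.symm _ hq _ ha, hd.symm _ hp _ ha]
    linarith

end

/-- `p` is a holomorphic covering map of the unit disk onto `Ω` which pushes the hyperbolic
density of the disk forward to `lam`. -/
structure IsPoincareCover (Ω : Set ℂ) (lam : ℂ → ℝ) (p : ℂ → ℂ) : Prop where
  differentiableAt : ∀ z ∈ ball (0 : ℂ) 1, DifferentiableAt ℂ p z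
  image_eq : p '' ball (0 : ℂ) 1 = Ω
  isCoveringMapOn : IsCoveringMapOn (fun z : ball (0 : ℂ) 1 => p z) Ω
  mul_norm_deriv : ∀ z ∈ ball (0 : ℂ) 1, lam (p z) * ‖deriv p z‖ = 2 / (1 - ‖z‖ ^ 2)

section

variable {Ω : Set ℂ} {lam : ℂ → ℝ} {p : ℂ → ℂ} {a z : ℂ}

theorem one_sub_norm_sq_pos (hz : z ∈ ball (0 : ℂ) 1) : 0 < 1 - ‖z‖ ^ 2 := by
  rw [mem_ball_zero_iff] at hz
  nlinarith [norm_nonneg z]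

theorem IsPoincareCover.mem (h : IsPoincareCover Ω lam p) (hz : z ∈ ball (0 : ℂ) 1) : p z ∈ Ω :=
  h.image_eq ▸ mem_image_of_mem p hz

theorem IsPoincareCover.exists_eq (h : IsPoincareCover Ω lam p) (hz : z ∈ Ω) :
    ∃ w ∈ ball (0 : ℂ) 1, p w = z := by
  rwa [← h.image_eq] at hz

theorem IsPoincareCover.deriv_ne_zero (h : IsPoincareCover Ω lam p) (hz : z ∈ ball (0 : ℂ) 1) :
    deriv p z ≠ 0 := by
  intro h0
  have h1 := h.mul_norm_deriv z hz
  rw [h0, norm_zero, mul_zero] at h1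
  exact (div_pos two_pos (one_sub_norm_sq_pos hz)).ne h1

theorem IsPoincareCover.density_eq (h : IsPoincareCover Ω lam p) (hz : z ∈ ball (0 : ℂ) 1) :
    lam (p z) = 2 / ((1 - ‖z‖ ^ 2) * ‖deriv p z‖) := by
  have h1 := norm_pos_iff.2 (h.deriv_ne_zero hz)
  rw [← div_div, ← h.mul_norm_deriv z hz, mul_div_cancel_right₀ _ h1.ne']

theorem IsPoincareCover.density_pos (h : IsPoincareCover Ω lam p) (hz : z ∈ Ω) : 0 < lam z := by
  obtain ⟨w, hw, rfl⟩ := h.exists_eq hz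
  rw [h.density_eq hw]
  exact div_pos two_pos (mul_pos (one_sub_norm_sq_pos hw) (norm_pos_iff.2 (h.deriv_ne_zero hw)))

theorem IsPoincareCover.analyticAt (h : IsPoincareCover Ω lam p) (hz : z ∈ ball (0 : ℂ) 1) :
    AnalyticAt ℂ p z :=
  (show DifferentiableOn ℂ p (ball 0 1) from
    fun w hw => (h.differentiableAt w hw).differentiableWithinAt).analyticAt
    (isOpen_ball.mem_nhds hz)

/-- A local holomorphic inverse of the covering map. -/
theorem IsPoincareCover.exists_localInverse (h : IsPoincareCover Ω lam p)
    (hz : z ∈ ball (0 : ℂ) 1) :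
    ∃ q : ℂ → ℂ, q (p z) = z ∧ HasDerivAt q (deriv p z)⁻¹ (p z) ∧
      (∀ᶠ w in nhds z, q (p w) = w) ∧ ∀ᶠ w in nhds (p z), p (q w) = w := by
  have hs := (h.analyticAt hz).hasStrictDerivAt
  have h0 := h.deriv_ne_zero hz
  have hl := hs.eventually_left_inverse h0
  exact ⟨hs.localInverse _ _ _ h0, hl.self_of_nhds, (hs.to_localInverse h0).hasDerivAt, hl,
    hs.eventually_right_inverse h0⟩

theorem IsPoincareCover.continuousOn_density (h : IsPoincareCover Ω lam p) :
    ContinuousOn lam Ω := by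
  intro w hw
  obtain ⟨z, hz, rfl⟩ := h.exists_eq hw
  obtain ⟨q, hqz, hq, -, hr⟩ := h.exists_localInverse hz
  have hqc : ContinuousAt q (p z) := hq.continuousAt
  have hd : ContinuousAt (deriv p) z := (h.analyticAt hz).deriv.continuousAt
  have hb : ∀ᶠ w in nhds (p z), q w ∈ ball (0 : ℂ) 1 :=
    hqc.eventually_mem (by rw [hqz]; exact isOpen_ball.mem_nhds hz)
  refine ContinuousAt.continuousWithinAt ?_
  have hc : ContinuousAt (fun w => 2 / ((1 - ‖q w‖ ^ 2) * ‖deriv p (q w)‖)) (p z) := by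
    refine ContinuousAt.div continuousAt_const ((continuousAt_const.sub (hqc.norm.pow 2)).mul
      (ContinuousAt.comp (g := deriv p) (by rwa [hqz]) hqc).norm) ?_
    rw [hqz]
    exact (mul_pos (one_sub_norm_sq_pos hz) (norm_pos_iff.2 (h.deriv_ne_zero hz))).ne'
  refine hc.congr ?_
  filter_upwards [hb, hr] with w hw hpw
  rw [← h.density_eq hw, hpw]

/-- Lifting of holomorphic maps of star-shaped domains. -/
theorem IsPoincareCover.exists_lift (h : IsPoincareCover Ω lam p) {U : Set ℂ} (hU : IsOpen U)
    (hs : StarConvex ℝ a U) (ha : a ∈ U) {f : ℂ → ℂ} (hf : DifferentiableOn ℂ f U)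
    (hfU : MapsTo f U Ω) (hz : z ∈ ball (0 : ℂ) 1) (hza : p z = f a) :
    ∃ g : ℂ → ℂ, DifferentiableOn ℂ g U ∧ MapsTo g U (ball 0 1) ∧ g a = z ∧
      ∀ w ∈ U, p (g w) = f w := by
  have : ContractibleSpace U := hs.contractibleSpace ⟨a, ha⟩
  have := hU.locallyPathConnectedSpace
  obtain ⟨F, ⟨hF0, hF⟩, -⟩ := h.isCoveringMapOn.existsUnique_continuousMap_lifts
    (⟨fun w : U => f w, hf.continuousOn.domRestrict⟩ : C(U, ℂ)) (a₀ := ⟨a, ha⟩) (e₀ := ⟨z, hz⟩)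
    hza (fun w => hfU w.2)
  classical
  let g : ℂ → ℂ := fun w => if hw : w ∈ U then F ⟨w, hw⟩ else 0
  have hg : ∀ w (hw : w ∈ U), g w = F ⟨w, hw⟩ := fun w hw => dif_pos hw
  have hmap : MapsTo g U (ball 0 1) := fun w hw => by rw [hg w hw]; exact (F ⟨w, hw⟩).2
  have hpg : ∀ w ∈ U, p (g w) = f w := fun w hw => by
    rw [hg w hw]; exact congrFun hF ⟨w, hw⟩
  have hcont : ContinuousOn g U := by
    rw [continuousOn_iff_continuous_domRestrict]
    convert continuous_subtype_val.comp F.continuous using 1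
    ext w
    exact hg w w.2
  refine ⟨g, fun w hw => ?_, hmap, by rw [hg a ha, hF0], hpg⟩
  obtain ⟨q, hqz, hq, hl, -⟩ := h.exists_localInverse (hmap hw)
  have hgw := hcont.continuousAt (hU.mem_nhds hw)
  rw [hpg w hw] at hq
  refine DifferentiableAt.differentiableWithinAt ?_
  refine (hq.differentiableAt.comp w (hf.differentiableAt (hU.mem_nhds hw))).congr_of_eventuallyEq ?_
  filter_upwards [hgw.eventually hl, hU.mem_nhds hw] with v hv hvU
  rw [Function.comp_apply, ← hpg v hvU, hv]

end

section

/-- The automorphism of the unit disk which maps `0` to `a`. -/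
def diskShift (a z : ℂ) : ℂ := (z + a) / (1 + (starRingEnd ℂ) a * z)

variable {a z w : ℂ}

theorem diskShift_zero (a : ℂ) : diskShift a 0 = a := by simp [diskShift]

theorem one_add_conj_mul_ne_zero (ha : a ∈ ball (0 : ℂ) 1) (hz : z ∈ ball (0 : ℂ) 1) :
    1 + (starRingEnd ℂ) a * z ≠ 0 := by
  intro h
  rw [mem_ball_zero_iff] at ha hz
  have h1 : ‖(starRingEnd ℂ) a * z‖ = 1 := by
    rw [eq_neg_of_add_eq_zero_right h, norm_neg, norm_one]
  rw [norm_mul, norm_conj] at h1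
  nlinarith [norm_nonneg a, norm_nonneg z]

theorem norm_one_add_conj_mul_sq (a z : ℂ) :
    ‖1 + (starRingEnd ℂ) a * z‖ ^ 2 = ‖z + a‖ ^ 2 + (1 - ‖a‖ ^ 2) * (1 - ‖z‖ ^ 2) := by
  simp only [Complex.sq_norm, normSq_apply, add_re, add_im, mul_re, mul_im, one_re, one_im, conj_re,
    conj_im]
  ring

theorem one_sub_norm_diskShift_sq (ha : a ∈ ball (0 : ℂ) 1) (hz : z ∈ ball (0 : ℂ) 1) :
    1 - ‖diskShift a z‖ ^ 2 =
      (1 - ‖a‖ ^ 2) * (1 - ‖z‖ ^ 2) / ‖1 + (starRingEnd ℂ) a * z‖ ^ 2 := by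
  have h := norm_pos_iff.2 (one_add_conj_mul_ne_zero ha hz)
  rw [diskShift, norm_div, div_pow, eq_div_iff (by positivity), sub_mul,
    div_mul_cancel₀ _ (by positivity), norm_one_add_conj_mul_sq]
  ring

theorem diskShift_mem (ha : a ∈ ball (0 : ℂ) 1) (hz : z ∈ ball (0 : ℂ) 1) :
    diskShift a z ∈ ball (0 : ℂ) 1 := by
  have h := norm_pos_iff.2 (one_add_conj_mul_ne_zero ha hz)
  have h1 : 0 < 1 - ‖diskShift a z‖ ^ 2 := by
    rw [one_sub_norm_diskShift_sq ha hz]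
    exact div_pos (mul_pos (one_sub_norm_sq_pos ha) (one_sub_norm_sq_pos hz)) (by positivity)
  rw [mem_ball_zero_iff]
  nlinarith [norm_nonneg (diskShift a z)]

theorem neg_mem_unitBall (ha : a ∈ ball (0 : ℂ) 1) : -a ∈ ball (0 : ℂ) 1 := by
  rwa [mem_ball_zero_iff, norm_neg, ← mem_ball_zero_iff]

theorem diskShift_neg_diskShift (ha : a ∈ ball (0 : ℂ) 1) (hz : z ∈ ball (0 : ℂ) 1) :
    diskShift (-a) (diskShift a z) = z := by
  have h := one_add_conj_mul_ne_zero ha hz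
  have h1 : 1 + (starRingEnd ℂ) (-a) * diskShift a z ≠ 0 :=
    one_add_conj_mul_ne_zero (neg_mem_unitBall ha) (diskShift_mem ha hz)
  have h2 : diskShift a z * (1 + (starRingEnd ℂ) a * z) = z + a := div_mul_cancel₀ _ h
  rw [diskShift, div_eq_iff h1, map_neg]
  refine mul_right_cancel₀ h ?_
  linear_combination (1 + (starRingEnd ℂ) a * z) * h2

theorem diskShift_diskShift_neg (ha : a ∈ ball (0 : ℂ) 1) (hz : z ∈ ball (0 : ℂ) 1) :
    diskShift a (diskShift (-a) z) = z := by
  simpa using diskShift_neg_diskShift (neg_mem_unitBall ha) hz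

theorem hasDerivAt_diskShift (ha : a ∈ ball (0 : ℂ) 1) (hz : z ∈ ball (0 : ℂ) 1) :
    HasDerivAt (diskShift a) ((1 - (starRingEnd ℂ) a * a) / (1 + (starRingEnd ℂ) a * z) ^ 2) z := by
  have h := one_add_conj_mul_ne_zero ha hz
  have h1 := ((hasDerivAt_id z).add_const a).div
    (((hasDerivAt_id z).const_mul ((starRingEnd ℂ) a)).const_add 1) h
  refine h1.congr_deriv ?_
  congr 1
  simp only [id]
  ring

theorem norm_deriv_diskShift (ha : a ∈ ball (0 : ℂ) 1) (hz : z ∈ ball (0 : ℂ) 1) :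
    ‖deriv (diskShift a) z‖ = (1 - ‖a‖ ^ 2) / ‖1 + (starRingEnd ℂ) a * z‖ ^ 2 := by
  have h1 : (1 : ℂ) - (starRingEnd ℂ) a * a = ((1 - ‖a‖ ^ 2 : ℝ) : ℂ) := by
    rw [mul_comm, mul_conj, Complex.normSq_eq_norm_sq]; push_cast; ring
  rw [(hasDerivAt_diskShift ha hz).deriv, norm_div, norm_pow, h1, norm_real, Real.norm_of_nonneg
    (one_sub_norm_sq_pos ha).le]

theorem continuousOn_diskShift (ha : a ∈ ball (0 : ℂ) 1) :
    ContinuousOn (diskShift a) (ball 0 1) :=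
  fun _ hz => (hasDerivAt_diskShift ha hz).continuousAt.continuousWithinAt

/-- `diskShift` as a homeomorphism of the unit disk. -/
def diskShiftHomeomorph (ha : a ∈ ball (0 : ℂ) 1) : ball (0 : ℂ) 1 ≃ₜ ball (0 : ℂ) 1 where
  toFun z := ⟨diskShift a z, diskShift_mem ha z.2⟩
  invFun z := ⟨diskShift (-a) z, diskShift_mem (neg_mem_unitBall ha) z.2⟩
  left_inv z := Subtype.ext (diskShift_neg_diskShift ha z.2)
  right_inv z := Subtype.ext (diskShift_diskShift_neg ha z.2)
  continuous_toFun := (continuousOn_diskShift ha).domRestrict.subtype_mk _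
  continuous_invFun := (continuousOn_diskShift (neg_mem_unitBall ha)).domRestrict.subtype_mk _

variable {Ω : Set ℂ} {lam : ℂ → ℝ} {p : ℂ → ℂ}

theorem IsPoincareCover.comp_diskShift (h : IsPoincareCover Ω lam p) (ha : a ∈ ball (0 : ℂ) 1) :
    IsPoincareCover Ω lam (p ∘ diskShift a) where
  differentiableAt z hz := (h.differentiableAt _ (diskShift_mem ha hz)).comp z
    (hasDerivAt_diskShift ha hz).differentiableAt
  image_eq := by
    refine Subset.antisymm ?_ fun w hw => ?_
    · rintro _ ⟨z, hz, rfl⟩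
      exact h.mem (diskShift_mem ha hz)
    · obtain ⟨z, hz, rfl⟩ := h.exists_eq hw
      exact ⟨_, diskShift_mem (neg_mem_unitBall ha) hz, congrArg p (diskShift_diskShift_neg ha hz)⟩
  isCoveringMapOn := h.isCoveringMapOn.comp_homeomorph (diskShiftHomeomorph ha)
  mul_norm_deriv z hz := by
    have hT := diskShift_mem ha hz
    have h1 := norm_pos_iff.2 (one_add_conj_mul_ne_zero ha hz)
    have h2 := one_sub_norm_sq_pos ha
    have h3 := one_sub_norm_sq_pos hz
    rw [deriv_comp z (h.differentiableAt _ hT) (hasDerivAt_diskShift ha hz).differentiableAt,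
      norm_mul, ← mul_assoc, Function.comp_apply, h.mul_norm_deriv _ hT,
      one_sub_norm_diskShift_sq ha hz, norm_deriv_diskShift ha hz]
    field_simp

theorem IsPoincareCover.exists_normalized (h : IsPoincareCover Ω lam p) (hw : w ∈ Ω) :
    ∃ p₁ : ℂ → ℂ, IsPoincareCover Ω lam p₁ ∧ p₁ 0 = w := by
  obtain ⟨a, ha, rfl⟩ := h.exists_eq hw
  exact ⟨_, h.comp_diskShift ha, congrArg p (diskShift_zero a)⟩

theorem zero_mem_unitBall : (0 : ℂ) ∈ ball (0 : ℂ) 1 := mem_ball_self one_pos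

/-- The conjugate of a holomorphic covering lifts through any normalized covering. -/
theorem IsPoincareCover.exists_lift_conj {p₁ : ℂ → ℂ} (h : IsPoincareCover Ω lam p)
    (h₁ : IsPoincareCover Ω lam p₁) (hΩ : ∀ z ∈ Ω, (starRingEnd ℂ) z ∈ Ω)
    (h0 : p₁ 0 = (starRingEnd ℂ) (p 0)) :
    ∃ g : ℂ → ℂ, DifferentiableOn ℂ g (ball 0 1) ∧ MapsTo g (ball 0 1) (ball 0 1) ∧ g 0 = 0 ∧
      (∀ z ∈ ball (0 : ℂ) 1, p₁ (g z) = (starRingEnd ℂ) (p ((starRingEnd ℂ) z))) ∧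
      ‖deriv p₁ 0‖ * ‖deriv g 0‖ = ‖deriv p 0‖ := by
  have hc : ∀ z ∈ ball (0 : ℂ) 1, (starRingEnd ℂ) z ∈ ball (0 : ℂ) 1 := fun z hz => by
    rwa [mem_ball_zero_iff, norm_conj, ← mem_ball_zero_iff]
  have hd : ∀ z ∈ ball (0 : ℂ) 1,
      HasDerivAt ((starRingEnd ℂ) ∘ p ∘ (starRingEnd ℂ))
        ((starRingEnd ℂ) (deriv p ((starRingEnd ℂ) z))) z := fun z hz => by
    have h2 := (h.differentiableAt _ (hc z hz)).hasDerivAt.conj_conj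
    rwa [conj_conj] at h2
  obtain ⟨g, hg, hgm, hg0, hpg⟩ := h₁.exists_lift (a := 0) (z := 0) isOpen_ball
    ((convex_ball (0 : ℂ) 1).starConvex zero_mem_unitBall) zero_mem_unitBall
    (f := (starRingEnd ℂ) ∘ p ∘ (starRingEnd ℂ))
    (fun z hz => (hd z hz).differentiableAt.differentiableWithinAt)
    (fun z hz => hΩ _ (h.mem (hc z hz))) zero_mem_unitBall (by simp [h0])
  refine ⟨g, hg, hgm, hg0, hpg, ?_⟩
  have hg' := hg.differentiableAt (isOpen_ball.mem_nhds zero_mem_unitBall)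
  have h3 : HasDerivAt (p₁ ∘ g) (deriv p₁ 0 * deriv g 0) 0 := by
    refine HasDerivAt.comp 0 ?_ hg'.hasDerivAt
    rw [hg0]
    exact (h₁.differentiableAt 0 zero_mem_unitBall).hasDerivAt
  have h4 := (hd 0 zero_mem_unitBall).congr_of_eventuallyEq
    (show p₁ ∘ g =ᶠ[nhds 0] _ from by
      filter_upwards [isOpen_ball.mem_nhds zero_mem_unitBall] with z hz using hpg z hz)
  have h5 := congrArg norm (h3.unique h4)
  rwa [norm_mul, norm_conj, map_zero] at h5

theorem IsPoincareCover.density_conj (h : IsPoincareCover Ω lam p)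
    (hΩ : ∀ z ∈ Ω, (starRingEnd ℂ) z ∈ Ω) (hw : w ∈ Ω) :
    lam ((starRingEnd ℂ) w) = lam w := by
  have key : ∀ v ∈ Ω, lam ((starRingEnd ℂ) v) ≤ lam v := by
    intro v hv
    obtain ⟨p₁, h₁, h10⟩ := h.exists_normalized hv
    obtain ⟨p₂, h₂, h20⟩ := h.exists_normalized (hΩ v hv)
    obtain ⟨g, hg, hgm, hg0, -, hg'⟩ := h₁.exists_lift_conj h₂ hΩ (by rw [h10, h20])
    have h3 : ‖deriv g 0‖ ≤ 1 :=
      Complex.norm_deriv_le_one_of_mapsTo_ball hg 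
        (by rw [hg0]; exact hgm.mono_right ball_subset_closedBall) one_pos
    have h4 := h₁.density_eq zero_mem_unitBall
    have h5 := h₂.density_eq zero_mem_unitBall
    rw [h10] at h4
    rw [h20] at h5
    rw [h4, h5]
    have h6 := norm_pos_iff.2 (h₁.deriv_ne_zero zero_mem_unitBall)
    have h7 : ‖deriv p₁ 0‖ ≤ ‖deriv p₂ 0‖ := by
      rw [← hg']
      exact mul_le_of_le_one_right (norm_nonneg _) h3
    simp only [norm_zero]
    gcongr
  refine le_antisymm (key w hw) ?_
  simpa using key _ (hΩ w hw)

end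

theorem HasDerivAt.eventually_norm_sub_le {𝕜 F : Type*} [NontriviallyNormedField 𝕜]
    [NormedAddCommGroup F] [NormedSpace 𝕜 F] {f : 𝕜 → F} {f' : F} {x : 𝕜} {r : ℝ}
    (hf : HasDerivAt f f' x) (hr : ‖f'‖ < r) :
    ∀ᶠ z in nhds x, ‖f z - f x‖ ≤ r * ‖z - x‖ := by
  filter_upwards [(hasDerivAt_iff_isLittleO.1 hf).bound (sub_pos.2 hr)] with z hz
  have h1 := norm_le_norm_sub_add (f z - f x) ((z - x) • f')
  rw [norm_smul] at h1
  linarith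

theorem Real.hasDerivAt_artanh {x : ℝ} (hx : x ∈ Ioo (-1 : ℝ) 1) :
    HasDerivAt Real.artanh (1 / (1 - x ^ 2)) x := by
  have h1 : 0 < 1 + x := by linarith [hx.1]
  have h2 : 0 < 1 - x := by linarith [hx.2]
  have h3 : HasDerivAt (fun y : ℝ => 1 / 2 * Real.log ((1 + y) / (1 - y))) (1 / (1 - x ^ 2)) x := by
    have h4 := ((((hasDerivAt_id x).const_add 1).div ((hasDerivAt_id x).const_sub 1)
      h2.ne').log (div_pos h1 h2).ne').const_mul (1 / 2)
    refine h4.congr_deriv ?_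
    have h5 : 1 - x ^ 2 = (1 + x) * (1 - x) := by ring
    simp only [id, Pi.div_apply]
    rw [h5]
    field_simp
    ring
  refine h3.congr_of_eventuallyEq ?_
  filter_upwards [Ioo_mem_nhds hx.1 hx.2] with y hy
  exact Real.artanh_eq_half_log (Ioo_subset_Icc_self hy)

section

variable {Ω : Set ℂ} {lam : ℂ → ℝ} {p s : ℂ → ℂ} {x y z w : ℂ}

/-- The part of `Ω` which is visible from the imaginary unit. -/
def starPart (Ω : Set ℂ) : Set ℂ := {z | ∀ t ∈ Icc (0 : ℝ) 1, I + t * (z - I) ∈ Ω}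

theorem IsSlitPlane.isOpen_starPart (h : IsSlitPlane Ω) : IsOpen (starPart Ω) := by
  refine isOpen_iff_mem_nhds.2 fun z hz => ?_
  refine isCompact_Icc.eventually_forall_of_forall_eventually fun t ht => ?_
  have hc : Continuous fun q : ℂ × ℝ => I + (q.2 : ℂ) * (q.1 - I) := by fun_prop
  exact hc.continuousAt.eventually_mem (h.isOpen.mem_nhds (hz t ht))

theorem starPart_subset : starPart Ω ⊆ Ω := fun z hz => by
  simpa using hz 1 ⟨zero_le_one, le_rfl⟩

theorem starConvex_starPart : StarConvex ℝ I (starPart Ω) := by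
  intro z hz a b ha hb hab t ht
  have h1 := hz (t * b) ⟨mul_nonneg ht.1 hb, mul_le_one₀ ht.2 hb (by linarith)⟩
  have h2 : (a : ℂ) = 1 - b := by
    rw [eq_sub_iff_add_eq]
    exact_mod_cast hab
  convert h1 using 1
  simp only [real_smul, h2]
  push_cast
  ring

theorem IsSlitPlane.upperPart_subset_starPart (h : IsSlitPlane Ω) :
    upperPart Ω ⊆ starPart Ω := by
  intro z hz t ht
  rcases ht.2.eq_or_lt with rfl | h1
  · simpa using hz.1
  · refine h.mem_of_im_ne_zero _ ?_
    have h2 : (I + t * (z - I)).im = (1 - t) + t * z.im := by simp; ring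
    rw [h2]
    have := mul_nonneg ht.1 hz.2
    exact (by linarith : (0 : ℝ) < (1 - t) + t * z.im).ne'

theorem IsSlitPlane.I_mem_upperPart (h : IsSlitPlane Ω) : I ∈ upperPart Ω :=
  ⟨h.mem_of_im_ne_zero I (by simp), by simp⟩

theorem IsPoincareCover.isSymmDensityOn (h : IsPoincareCover Ω lam p) (hS : IsSlitPlane Ω) :
    IsSymmDensityOn Ω lam where
  isOpen := hS.isOpen
  isConnected := hS.isConnected
  continuousOn := h.continuousOn_density
  nonneg _ hz := (h.density_pos hz).le
  conj_mem _ hz := hS.conj_mem hz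
  map_conj _ hz := h.density_conj (fun _ hw => hS.conj_mem hw) hz

/-- `s` is a holomorphic section of the covering `p` over the visible part of `Ω`. -/
structure IsPoincareSection (Ω : Set ℂ) (lam : ℂ → ℝ) (p s : ℂ → ℂ) : Prop
    extends IsPoincareCover Ω lam p where
  differentiableOn : DifferentiableOn ℂ s (starPart Ω)
  mapsTo : MapsTo s (starPart Ω) (ball 0 1)
  rightInverse : ∀ z ∈ starPart Ω, p (s z) = z

theorem IsPoincareCover.exists_section (h : IsPoincareCover Ω lam p) (hS : IsSlitPlane Ω) :
    ∃ s, IsPoincareSection Ω lam p s := by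
  have hI := hS.upperPart_subset_starPart hS.I_mem_upperPart
  obtain ⟨a, ha, hpa⟩ := h.exists_eq (starPart_subset hI)
  obtain ⟨s, h1, h2, -, h4⟩ := h.exists_lift hS.isOpen_starPart starConvex_starPart hI
    differentiableOn_id starPart_subset ha hpa
  exact ⟨s, h, h1, h2, h4⟩

theorem IsPoincareSection.comp_diskShift (h : IsPoincareSection Ω lam p s) {a : ℂ}
    (ha : a ∈ ball (0 : ℂ) 1) :
    IsPoincareSection Ω lam (p ∘ diskShift a) (diskShift (-a) ∘ s) where
  toIsPoincareCover := h.toIsPoincareCover.comp_diskShift ha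
  differentiableOn z hz := ((hasDerivAt_diskShift (neg_mem_unitBall ha)
    (h.mapsTo hz)).differentiableAt.comp_differentiableWithinAt z (h.differentiableOn z hz))
  mapsTo _ hz := diskShift_mem (neg_mem_unitBall ha) (h.mapsTo hz)
  rightInverse z hz := by
    simp only [Function.comp_apply]
    rw [diskShift_diskShift_neg ha (h.mapsTo hz), h.rightInverse z hz]

theorem norm_mem_Ioo (hz : z ∈ ball (0 : ℂ) 1) : ‖z‖ ∈ Ioo (-1 : ℝ) 1 :=
  ⟨by linarith [norm_nonneg z], mem_ball_zero_iff.1 hz⟩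

theorem IsPoincareCover.densityDist_le (h : IsPoincareCover Ω lam p) (hS : IsSlitPlane Ω)
    (hz : z ∈ ball (0 : ℂ) 1) : densityDist Ω lam (p 0) (p z) ≤ 2 * Real.artanh ‖z‖ := by
  have hb : ∀ t ∈ Icc (0 : ℝ) 1, (t : ℂ) * z ∈ ball (0 : ℂ) 1 := fun t ht => by
    rw [mem_ball_zero_iff, norm_mul, norm_real, Real.norm_of_nonneg ht.1]
    exact (mul_le_of_le_one_left (norm_nonneg z) ht.2).trans_lt (mem_ball_zero_iff.1 hz)
  have hd : ∀ t ∈ Icc (0 : ℝ) 1,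
      HasDerivAt (fun t : ℝ => p (t * z)) (deriv p (t * z) * z) t := fun t ht => by
    have h1 : HasDerivAt (fun t : ℝ => (t : ℂ) * z) z t := by
      simpa using ((hasDerivAt_id t).ofReal_comp).mul_const z
    exact (h.differentiableAt _ (hb t ht)).hasDerivAt.comp t h1
  have hγ : IsCurveIn Ω (fun t : ℝ => p (t * z)) (p 0) (p z) := by
    refine ⟨fun t ht => ?_, by simp, by simp, fun t ht => h.mem (hb t ht)⟩
    have h1 : ContDiffAt ℝ 1 p (t * z) := (h.analyticAt (hb t ht)).contDiffAt.restrict_scalars ℝ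
    have h2 : ContDiffAt ℝ 1 (fun t : ℝ => (t : ℂ) * z) t :=
      ofRealCLM.contDiff.contDiffAt.mul contDiffAt_const
    exact (h1.comp t h2).contDiffWithinAt
  have hn : ∀ t ∈ Icc (0 : ℝ) 1, t * ‖z‖ ∈ Ioo (-1 : ℝ) 1 := fun t ht => by
    have h1 := norm_mem_Ioo (hb t ht)
    rwa [norm_mul, norm_real, Real.norm_of_nonneg ht.1] at h1
  have key := hγ.densityDist_le_sub (h.isSymmDensityOn hS).toIsDensityOn
    (B := fun t => 2 * Real.artanh (t * ‖z‖)) (B' := fun t => 2 / (1 - (t * ‖z‖) ^ 2) * ‖z‖)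
    (fun t ht => ?_) fun t ht => ?_
  · simpa using key
  · have h1 := ((Real.hasDerivAt_artanh (hn t ht)).comp t
      ((hasDerivAt_id t).mul_const ‖z‖)).const_mul 2
    refine h1.congr_deriv ?_
    ring
  · have ht' := Ioo_subset_Icc_self ht
    have h1 := h.mul_norm_deriv _ (hb t ht')
    rw [(hd t ht').deriv, norm_mul, ← mul_assoc, h1, norm_mul, norm_real,
      Real.norm_of_nonneg ht'.1]

theorem IsPoincareSection.norm_deriv (h : IsPoincareSection Ω lam p s) (hS : IsSlitPlane Ω)
    (hz : z ∈ starPart Ω) :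
    ∃ s', HasDerivAt s s' z ∧ 2 / (1 - ‖s z‖ ^ 2) * ‖s'‖ = lam z := by
  have hs := (h.differentiableOn.differentiableAt (hS.isOpen_starPart.mem_nhds hz)).hasDerivAt
  refine ⟨_, hs, ?_⟩
  have h1 := ((h.differentiableAt _ (h.mapsTo hz)).hasDerivAt).comp z hs
  have h2 : p ∘ s =ᶠ[nhds z] id := by
    filter_upwards [hS.isOpen_starPart.mem_nhds hz] with w hw using h.rightInverse w hw
  have h3 := congrArg norm ((h1.congr_of_eventuallyEq h2.symm).unique (hasDerivAt_id z))
  rw [norm_mul, norm_one] at h3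
  rw [← h.mul_norm_deriv _ (h.mapsTo hz), h.rightInverse z hz, mul_assoc, h3, mul_one]

theorem IsPoincareSection.le_densityDist (h : IsPoincareSection Ω lam p s) (hS : IsSlitPlane Ω)
    (hx : x ∈ upperPart Ω) (hy : y ∈ upperPart Ω) (h0 : s x = 0) :
    2 * Real.artanh ‖s y‖ ≤ densityDist Ω lam x y := by
  have hsym := h.toIsPoincareCover.isSymmDensityOn hS
  refine le_of_forall_pos_le_add fun ε hε => ?_
  obtain ⟨γ, hγ, hlen⟩ := hsym.exists_curveLen_lt hx.1 hy.1 hε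
  refine le_trans ?_ hlen.le
  obtain ⟨ℓ, hℓ', hℓ⟩ := hγ.exists_lengthFunction hsym.toIsDensityOn
  have hF : ∀ t ∈ Icc (0 : ℝ) 1, upperFold (γ t) ∈ starPart Ω := fun t ht =>
    hS.upperPart_subset_starPart ⟨hsym.upperFold_mem (hγ.mapsTo t ht), upperFold_im_nonneg _⟩
  have m0 : (0 : ℝ) ∈ Icc (0 : ℝ) 1 := ⟨le_rfl, zero_le_one⟩
  have m1 : (1 : ℝ) ∈ Icc (0 : ℝ) 1 := ⟨zero_le_one, le_rfl⟩
  have hfold : Continuous upperFold :=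
    (LipschitzWith.of_dist_le' (K := 1) fun z w => by
      rw [dist_eq_norm, dist_eq_norm, one_mul]; exact norm_upperFold_sub_le z w).continuous
  have hσ : ContinuousOn (fun t => s (upperFold (γ t))) (Icc 0 1) :=
    h.differentiableOn.continuousOn.comp (hfold.comp_continuousOn hγ.continuousOn) hF
  have hcont : ContinuousOn (fun t => 2 * Real.artanh ‖s (upperFold (γ t))‖) (Icc 0 1) := by
    intro t ht
    have h1 := (Real.hasDerivAt_artanh (norm_mem_Ioo (h.mapsTo (hF t ht)))).continuousAt
    exact continuousWithinAt_const.mul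
      (ContinuousAt.comp_continuousWithinAt (g := Real.artanh) h1 (hσ t ht).norm)
  have hlam : ∀ t ∈ Icc (0 : ℝ) 1, lam (upperFold (γ t)) = lam (γ t) := fun t ht => by
    rw [upperFold]
    split_ifs
    · rfl
    · exact hsym.map_conj _ (hγ.mapsTo t ht)
  have key := image_le_of_liminf_slope_right_le_deriv_boundary hcont
    (B := fun t => ℓ t - ℓ 0) (B' := curveSpeed lam γ) ?_
    (fun t ht => ((hℓ' t ht).continuousAt.continuousWithinAt).sub continuousWithinAt_const)
    (fun t ht => ((hℓ' t (Ico_subset_Icc_self ht)).sub_const _).hasDerivWithinAt) ?_ m1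
  · rw [curveLen_eq_integral_curveSpeed, hℓ 0 m0 1 m1]
    simpa only [hγ.target, upperFold_of_nonneg hy.2] using key
  · simp [hγ.source, upperFold_of_nonneg hx.2, h0]
  · intro t ht r hr
    have ht01 := Ico_subset_Icc_self ht
    set w := upperFold (γ t) with hw
    obtain ⟨s', hs', hs'e⟩ := h.norm_deriv hS (hF t ht01)
    rw [← hw, hlam t ht01] at hs'e
    have hsw := h.mapsTo (hF t ht01)
    have hart := Real.hasDerivAt_artanh (norm_mem_Ioo hsw)
    have hγ' := ((hγ.hasDerivWithinAt ht01).mono (Icc_subset_Icc_left ht01.1)).mono_of_mem_nhdsWithin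
      (Icc_mem_nhdsGE ht.2)
    obtain ⟨η, hη, hη0⟩ : ∃ η : ℝ, 2 * (1 / (1 - ‖s w‖ ^ 2) + η) * (‖s'‖ + η) *
        (‖derivWithin γ (Icc 0 1) t‖ + η) < r ∧ 0 < η := by
      have hc : ContinuousAt (fun η : ℝ => 2 * (1 / (1 - ‖s w‖ ^ 2) + η) * (‖s'‖ + η) *
        (‖derivWithin γ (Icc 0 1) t‖ + η)) 0 := by fun_prop
      have h1 : 2 * (1 / (1 - ‖s w‖ ^ 2) + 0) * (‖s'‖ + 0) *
          (‖derivWithin γ (Icc 0 1) t‖ + 0) < r := by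
        rw [curveSpeed, ← hs'e] at hr
        convert hr using 1
        ring
      exact ((hc.eventually_lt continuousAt_const h1).filter_mono nhdsWithin_le_nhds |>.and
        self_mem_nhdsWithin : ∀ᶠ η in nhdsWithin (0 : ℝ) (Ioi 0), _ ∧ _).exists
    have hpos : 0 < 1 / (1 - ‖s w‖ ^ 2) := one_div_pos.2 (one_sub_norm_sq_pos hsw)
    have hγc : ContinuousWithinAt γ (Ici t) t := hγ'.continuousWithinAt
    have hγI : Tendsto γ (nhdsWithin t (Ioi t)) (nhds (γ t)) :=
      hγc.mono_left (nhdsWithin_mono t Ioi_subset_Ici_self)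
    have hfI : Tendsto (fun u => upperFold (γ u)) (nhdsWithin t (Ioi t)) (nhds w) :=
      (hfold.tendsto _).comp hγI
    have e1 := hfI.eventually (hs'.eventually_norm_sub_le (lt_add_of_pos_right _ hη0))
    have e2 := (((hs'.continuousAt.tendsto.comp hfI).norm)).eventually
      (hart.eventually_norm_sub_le (r := 1 / (1 - ‖s w‖ ^ 2) + η)
        (by rw [Real.norm_of_nonneg hpos.le]; linarith))
    have e3 := (hγ'.Ioi_of_Ici.limsup_norm_slope_le (lt_add_of_pos_right _ hη0))
    refine Eventually.frequently ?_
    filter_upwards [e1, e2, e3, self_mem_nhdsWithin] with u h1 h2 h3 h4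
    have hut : 0 < u - t := sub_pos.2 h4
    rw [Real.norm_of_nonneg hut.le, inv_mul_lt_iff₀ hut] at h3
    have h5 := norm_upperFold_sub_le (γ u) (γ t)
    have h6 : ‖s (upperFold (γ u)) - s w‖ ≤ (‖s'‖ + η) * ((u - t) *
        (‖derivWithin γ (Icc 0 1) t‖ + η)) :=
      h1.trans (by gcongr; exact h5.trans h3.le)
    have h7 : Real.artanh ‖s (upperFold (γ u))‖ - Real.artanh ‖s w‖ ≤
        (1 / (1 - ‖s w‖ ^ 2) + η) * ((‖s'‖ + η) * ((u - t) *
        (‖derivWithin γ (Icc 0 1) t‖ + η))) :=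
      (le_abs_self _).trans (h2.trans (by
        gcongr
        exact (abs_norm_sub_norm_le _ _).trans h6))
    rw [slope_def_field, div_lt_iff₀ hut]
    calc _ = 2 * (Real.artanh ‖s (upperFold (γ u))‖ - Real.artanh ‖s w‖) := by ring
      _ ≤ 2 * (1 / (1 - ‖s w‖ ^ 2) + η) * (‖s'‖ + η) *
        (‖derivWithin γ (Icc 0 1) t‖ + η) * (u - t) := by linarith
      _ < r * (u - t) := by gcongr

end

/-- A metric of the form `2 * arsinh (‖x - y‖ * c x * c y)` satisfies the four point condition, as a
consequence of Ptolemy's inequality. -/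
theorem fourPointOn_of_sinh_eq {α : Type*} {X : Set α} {d : α → α → ℝ} (hd : IsPseudoDistOn X d)
    (f : α → ℂ) (c : α → ℝ) (hc : ∀ x ∈ X, 0 ≤ c x)
    (h : ∀ x ∈ X, ∀ y ∈ X, Real.sinh (d x y / 2) = ‖f x - f y‖ * (c x * c y)) :
    FourPointOn X d 6 := by
  intro x hx y hy z hz w hw
  rcases lt_or_ge (d x y) 1 with h1 | h1
  · have h2 := hd.triangle z hz x hx w hw
    have h3 := hd.triangle x hx y hy w hw
    rw [hd.symm z hz x hx] at h2
    linarith [le_max_left (d x z + d y w) (d x w + d y z)]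
  rcases lt_or_ge (d z w) 1 with h2 | h2
  · have h3 := hd.triangle x hx z hz y hy
    have h4 := hd.triangle z hz w hw y hy
    rw [hd.symm w hw y hy] at h4
    linarith [le_max_left (d x z + d y w) (d x w + d y z)]
  have hlow : ∀ u : ℝ, 1 ≤ u → Real.exp (u / 2) / 4 ≤ Real.sinh (u / 2) := fun u hu => by
    rw [Real.sinh_eq]
    have h3 : Real.exp (-(u / 2)) * Real.exp u = Real.exp (u / 2) := by
      rw [← Real.exp_add]; congr 1; ring
    have h4 := Real.add_one_le_exp u
    nlinarith [Real.exp_pos (-(u / 2))]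
  have hupp : ∀ u : ℝ, Real.sinh (u / 2) ≤ Real.exp (u / 2) / 2 := fun u => by
    rw [Real.sinh_eq]
    linarith [Real.exp_pos (-(u / 2))]
  have hnn : ∀ x ∈ X, ∀ y ∈ X, 0 ≤ Real.sinh (d x y / 2) := fun x hx y hy =>
    Real.sinh_nonneg_iff.2 (by linarith [hd.nonneg x hx y hy])
  have hpt := EuclideanGeometry.mul_dist_le_mul_dist_add_mul_dist (f x) (f z) (f y) (f w)
  simp only [dist_eq_norm] at hpt
  have hS : Real.sinh (d x y / 2) * Real.sinh (d z w / 2) ≤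
      Real.sinh (d x z / 2) * Real.sinh (d y w / 2) +
        Real.sinh (d x w / 2) * Real.sinh (d y z / 2) := by
    have hC : 0 ≤ c x * c y * (c z * c w) :=
      mul_nonneg (mul_nonneg (hc x hx) (hc y hy)) (mul_nonneg (hc z hz) (hc w hw))
    rw [h x hx y hy, h z hz w hw, h x hx z hz, h y hy w hw, h x hx w hw, h y hy z hz,
      norm_sub_rev (f y) (f z)]
    linarith [mul_le_mul_of_nonneg_right hpt hC]
  set M := max (d x z + d y w) (d x w + d y z)
  have e1 : Real.exp ((d x y + d z w) / 2) / 16 ≤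
      Real.sinh (d x y / 2) * Real.sinh (d z w / 2) := by
    have h3 := mul_le_mul (hlow _ h1) (hlow _ h2) (by positivity) (hnn x hx y hy)
    rw [add_div, Real.exp_add]
    linarith
  have hprod : ∀ u v : ℝ, 0 ≤ Real.sinh (v / 2) → u + v ≤ M →
      Real.sinh (u / 2) * Real.sinh (v / 2) ≤ Real.exp (M / 2) / 4 := fun u v hv huv => by
    have h3 := mul_le_mul (hupp u) (hupp v) hv (by positivity)
    have h4 : Real.exp (u / 2) * Real.exp (v / 2) ≤ Real.exp (M / 2) := by
      rw [← Real.exp_add]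
      exact Real.exp_le_exp.2 (by linarith)
    linarith
  have e2 := hprod _ _ (hnn y hy w hw) (le_max_left (d x z + d y w) (d x w + d y z))
  have e3 := hprod _ _ (hnn y hy z hz) (le_max_right (d x z + d y w) (d x w + d y z))
  have e4 : Real.exp ((d x y + d z w) / 2) ≤ Real.exp 3 * Real.exp (M / 2) := by
    have h3 : (8 : ℝ) ≤ Real.exp 3 := by
      have h4 := Real.add_one_le_exp (1 : ℝ)
      have h5 : Real.exp 3 = Real.exp 1 ^ 3 := by rw [← Real.exp_nat_mul]; norm_num
      rw [h5]
      calc (8 : ℝ) = 2 ^ 3 := by norm_num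
        _ ≤ _ := by gcongr; linarith
    nlinarith [Real.exp_pos (M / 2)]
  rw [← Real.exp_add, Real.exp_le_exp] at e4
  linarith

section

variable {Ω : Set ℂ} {lam : ℂ → ℝ} {p s : ℂ → ℂ} {x y z w : ℂ}

theorem diskShift_neg_self {a : ℂ} (ha : a ∈ ball (0 : ℂ) 1) : diskShift (-a) a = 0 := by
  simpa only [diskShift_zero] using diskShift_neg_diskShift ha zero_mem_unitBall

theorem IsPoincareSection.densityDist_eq (h : IsPoincareSection Ω lam p s) (hS : IsSlitPlane Ω)
    (hx : x ∈ upperPart Ω) (hy : y ∈ upperPart Ω) (h0 : s x = 0) :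
    densityDist Ω lam x y = 2 * Real.artanh ‖s y‖ := by
  refine le_antisymm ?_ (h.le_densityDist hS hx hy h0)
  have hy' := hS.upperPart_subset_starPart hy
  have h1 := h.densityDist_le hS (h.mapsTo hy')
  rwa [← h0, h.rightInverse x (hS.upperPart_subset_starPart hx), h.rightInverse y hy'] at h1

theorem IsPoincareSection.sinh_densityDist (h : IsPoincareSection Ω lam p s) (hS : IsSlitPlane Ω)
    (hx : x ∈ upperPart Ω) (hy : y ∈ upperPart Ω) :
    Real.sinh (densityDist Ω lam x y / 2) =
      ‖s x - s y‖ * ((√(1 - ‖s x‖ ^ 2))⁻¹ * (√(1 - ‖s y‖ ^ 2))⁻¹) := by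
  have ha := h.mapsTo (hS.upperPart_subset_starPart hx)
  have hb := h.mapsTo (hS.upperPart_subset_starPart hy)
  have ha' := neg_mem_unitBall ha
  rw [(h.comp_diskShift ha).densityDist_eq hS hx hy (diskShift_neg_self ha),
    mul_div_cancel_left₀ _ two_ne_zero, Function.comp_apply,
    Real.sinh_artanh (norm_mem_Ioo (diskShift_mem ha' hb)), one_sub_norm_diskShift_sq ha' hb,
    Real.sqrt_div' _ (sq_nonneg _), Real.sqrt_sq (norm_nonneg _), norm_neg,
    Real.sqrt_mul (one_sub_norm_sq_pos ha).le, diskShift, norm_div, ← sub_eq_add_neg,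
    norm_sub_rev (s y)]
  have h1 := norm_pos_iff.2 (one_add_conj_mul_ne_zero ha' hb)
  have h2 := Real.sqrt_pos.2 (one_sub_norm_sq_pos ha)
  have h3 := Real.sqrt_pos.2 (one_sub_norm_sq_pos hb)
  generalize ‖1 + (starRingEnd ℂ) (-s x) * s y‖ = D at h1 ⊢
  field_simp

theorem IsPoincareCover.fourPointOn (h : IsPoincareCover Ω lam p) (hS : IsSlitPlane Ω) :
    FourPointOn (upperPart Ω) (densityDist Ω lam) 6 := by
  obtain ⟨s, hs⟩ := h.exists_section hS
  exact fourPointOn_of_sinh_eq ((h.isSymmDensityOn hS).isPseudoDistOn.mono fun _ hz => hz.1) s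
    (fun x => (√(1 - ‖s x‖ ^ 2))⁻¹) (fun _ _ => by positivity)
    fun x hx y hy => hs.sinh_densityDist hS hx hy

theorem IsSlitPlane.ofReal_mem_upperPart {t : ℝ} (ht : (t : ℂ) ∈ Ω) : (t : ℂ) ∈ upperPart Ω :=
  ⟨ht, by simp⟩

/-- The reflection principle: a section of the covering over a real interval on which it vanishes
somewhere has values in a diameter of the disk. -/
theorem IsPoincareSection.exists_eq_mul_conj (h : IsPoincareSection Ω lam p s) (hS : IsSlitPlane Ω)
    {J : Set ℝ} (hJo : IsOpen J) (hJ : J.OrdConnected) (hJΩ : ∀ t ∈ J, (t : ℂ) ∈ Ω) {q : ℝ}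
    (hq : q ∈ J) (h0 : s q = 0) :
    ∃ c : ℂ, ‖c‖ = 1 ∧ ∀ t ∈ J, s t = c * (starRingEnd ℂ) (s t) := by
  have hV : ∀ t ∈ J, (t : ℂ) ∈ starPart Ω := fun t ht =>
    hS.upperPart_subset_starPart (IsSlitPlane.ofReal_mem_upperPart (hJΩ t ht))
  have hp0 : p 0 = q := by rw [← h0, h.rightInverse _ (hV q hq)]
  obtain ⟨g, hg, hgm, hg0, hpg, hg'⟩ := h.exists_lift_conj h.toIsPoincareCover
    (fun _ hz => hS.conj_mem hz) (by rw [hp0, conj_ofReal])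
  have hg1 : ‖deriv g 0‖ = 1 :=
    mul_left_cancel₀ (norm_ne_zero_iff.2 (h.deriv_ne_zero zero_mem_unitBall))
      (hg'.trans (mul_one _).symm)
  obtain ⟨c, hc, hgc⟩ := Complex.affine_of_mapsTo_ball_of_exists_norm_dslope_eq_div' hg
    (R₂ := 1) (by rw [hg0]; exact hgm.mono_right ball_subset_closedBall)
    ⟨0, zero_mem_unitBall, by rw [dslope_same, hg1, div_one]⟩
  rw [div_one] at hc
  have hgc' : ∀ z ∈ ball (0 : ℂ) 1, g z = c * z := fun z hz => by
    rw [hgc hz]; simp [hg0, mul_comm]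
  refine ⟨c, hc, fun t ht => ?_⟩
  have hcb : ∀ z ∈ ball (0 : ℂ) 1, (starRingEnd ℂ) z ∈ ball (0 : ℂ) 1 := fun z hz => by
    rwa [mem_ball_zero_iff, norm_conj, ← mem_ball_zero_iff]
  have hsc : Continuous fun t : J => s (t : ℝ) :=
    h.differentiableOn.continuousOn.comp_continuous
      (continuous_ofReal.comp continuous_subtype_val) fun t => hV t t.2
  let F : C(J, ball (0 : ℂ) 1) :=
    ⟨fun t => ⟨s (t : ℝ), h.mapsTo (hV t t.2)⟩, hsc.subtype_mk _⟩
  let G : C(J, ball (0 : ℂ) 1) :=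
    ⟨fun t => ⟨g ((starRingEnd ℂ) (s (t : ℝ))), hgm (hcb _ (h.mapsTo (hV t t.2)))⟩,
      (hg.continuousOn.comp_continuous (continuous_conj.comp hsc)
        fun t => hcb _ (h.mapsTo (hV t t.2))).subtype_mk _⟩
  have : ContractibleSpace J := hJ.convex.contractibleSpace ⟨q, hq⟩
  have := hJo.locallyPathConnectedSpace
  have huniq := h.isCoveringMapOn.existsUnique_continuousMap_lifts
    (⟨fun t : J => ((t : ℝ) : ℂ), continuous_ofReal.comp continuous_subtype_val⟩ : C(J, ℂ))
    (a₀ := ⟨q, hq⟩) (e₀ := ⟨0, zero_mem_unitBall⟩) hp0 (fun t => hJΩ t t.2)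
  have hFG : F = G := by
    refine huniq.unique ⟨Subtype.ext h0, funext fun u => h.rightInverse _ (hV u u.2)⟩
      ⟨Subtype.ext ?_, funext fun u => ?_⟩
    · change g ((starRingEnd ℂ) (s q)) = 0
      rw [h0, map_zero, hg0]
    · change p (g ((starRingEnd ℂ) (s (u : ℝ)))) = (u : ℝ)
      rw [hpg _ (hcb _ (h.mapsTo (hV u u.2))), conj_conj, h.rightInverse _ (hV u u.2), conj_ofReal]
  have h1 : s t = g ((starRingEnd ℂ) (s t)) :=
    congrArg Subtype.val (DFunLike.congr_fun hFG ⟨t, ht⟩)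
  rwa [hgc' _ (hcb _ (h.mapsTo (hV t ht)))] at h1

/-- Real intervals are hyperbolic geodesics. -/
theorem IsPoincareCover.densityDist_add_of_interval (h : IsPoincareCover Ω lam p)
    (hS : IsSlitPlane Ω) {J : Set ℝ} (hJo : IsOpen J) (hJ : J.OrdConnected)
    (hJΩ : ∀ t ∈ J, (t : ℂ) ∈ Ω) {u q a : ℝ} (hu : u ∈ J) (hq : q ∈ J) (ha : a ∈ J)
    (huq : u < q) (hqa : q < a) :
    densityDist Ω lam u q + densityDist Ω lam q a = densityDist Ω lam u a := by
  have hup : ∀ t ∈ J, (t : ℂ) ∈ upperPart Ω := fun t ht =>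
    IsSlitPlane.ofReal_mem_upperPart (hJΩ t ht)
  have hV : ∀ t ∈ J, (t : ℂ) ∈ starPart Ω := fun t ht => hS.upperPart_subset_starPart (hup t ht)
  obtain ⟨s, p, hs, h0⟩ : ∃ s p, IsPoincareSection Ω lam p s ∧ s q = 0 := by
    obtain ⟨s, hs⟩ := h.exists_section hS
    have hsq := hs.mapsTo (hV q hq)
    exact ⟨_, _, hs.comp_diskShift hsq, diskShift_neg_self hsq⟩
  obtain ⟨c, hc, hsc⟩ := hs.exists_eq_mul_conj hS hJo hJ hJΩ hq h0
  obtain ⟨ζ, hζ⟩ := IsAlgClosed.exists_pow_nat_eq c two_pos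
  have hζ1 : ‖ζ‖ = 1 := by
    rw [← hζ, norm_pow] at hc
    exact (pow_eq_one_iff_of_nonneg (norm_nonneg _) two_ne_zero).1 hc
  have hζ2 : ζ * (starRingEnd ℂ) ζ = 1 := by
    rw [mul_conj, Complex.normSq_eq_norm_sq, hζ1]; simp
  set r : ℝ → ℝ := fun t => (s t * (starRingEnd ℂ) ζ).re with hr
  have hrs : ∀ t ∈ J, s t = r t * ζ := fun t ht => by
    have h1 : (starRingEnd ℂ) (s t * (starRingEnd ℂ) ζ) = s t * (starRingEnd ℂ) ζ := by
      conv_rhs => rw [hsc t ht, ← hζ]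
      rw [map_mul, conj_conj]
      linear_combination (-ζ * (starRingEnd ℂ) (s t)) * hζ2
    have h2 := conj_eq_iff_re.1 h1
    rw [hr, h2]
    linear_combination (-s t) * hζ2
  have hsub : Icc u a ⊆ J := hJ.out hu ha
  have hrc : ContinuousOn r (Icc u a) := by
    have h1 : ContinuousOn (fun t : ℝ => s t) (Icc u a) :=
      hs.differentiableOn.continuousOn.comp continuous_ofReal.continuousOn
        fun t ht => hV t (hsub ht)
    exact continuous_re.comp_continuousOn (h1.mul continuousOn_const)
  have hri : InjOn r (Icc u a) := by
    intro t ht t' ht' e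
    have h1 : s t = s t' := by rw [hrs t (hsub ht), hrs t' (hsub ht'), e]
    have h2 := congrArg p h1
    rw [hs.rightInverse _ (hV t (hsub ht)), hs.rightInverse _ (hV t' (hsub ht'))] at h2
    exact ofReal_injective h2
  have hr0 : r q = 0 := by simp [hr, h0]
  have hua := huq.trans hqa
  have mu : u ∈ Icc u a := ⟨le_rfl, hua.le⟩
  have mq : q ∈ Icc u a := ⟨huq.le, hqa.le⟩
  have ma : a ∈ Icc u a := ⟨hua.le, le_rfl⟩
  have habs : |r u - r a| = |r u| + |r a| := by
    rcases hrc.strictMonoOn_of_injOn_Icc' hua.le hri with hm | hm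
    · have h1 := hm mu mq huq
      have h2 := hm mq ma hqa
      rw [hr0] at h1 h2
      rw [abs_of_neg h1, abs_of_pos h2, abs_of_neg (by linarith)]
      ring
    · have h1 := hm mu mq huq
      have h2 := hm mq ma hqa
      rw [hr0] at h1 h2
      rw [abs_of_pos h1, abs_of_neg h2, abs_of_pos (by linarith)]
      ring
  have hnorm : ∀ t ∈ J, ‖s t‖ = |r t| := fun t ht => by
    rw [hrs t ht, norm_mul, hζ1, mul_one, norm_real, Real.norm_eq_abs]
  have hsub' : ‖s u - s a‖ = ‖s u‖ + ‖s a‖ := by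
    rw [hnorm u hu, hnorm a ha, ← habs, hrs u hu, hrs a ha, ← sub_mul, norm_mul, hζ1, mul_one,
      ← ofReal_sub, norm_real, Real.norm_eq_abs]
  have hsymm := (h.isSymmDensityOn hS).isPseudoDistOn.symm _ (hJΩ u hu) _ (hJΩ q hq)
  have hd := hs.sinh_densityDist hS (hup u hu) (hup a ha)
  rw [hsymm, hs.densityDist_eq hS (hup q hq) (hup u hu) h0,
    hs.densityDist_eq hS (hup q hq) (hup a ha) h0]
  have hnu := norm_mem_Ioo (hs.mapsTo (hV u hu))
  have hna := norm_mem_Ioo (hs.mapsTo (hV a ha))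
  have key : Real.sinh (Real.artanh ‖s u‖ + Real.artanh ‖s a‖) =
      Real.sinh (densityDist Ω lam u a / 2) := by
    rw [hd, Real.sinh_add, Real.sinh_artanh hnu, Real.sinh_artanh hna, Real.cosh_artanh hnu,
      Real.cosh_artanh hna, hsub']
    ring
  linarith [Real.sinh_injective key]

end

theorem gromovHyperbolicWith_of_eq_zero {α : Type*} {S : Set α} {d : α → α → ℝ} {δ : ℝ}
    (hd : ∀ x y, d x y = 0) (hδ : 0 ≤ δ) : GromovHyperbolicWith S d δ := by
  intro x _ y _ z _ gxy gxz gzy _ _ _ t _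
  exact ⟨gxz 0, Or.inl ⟨0, by simp [hd], rfl⟩, (hd _ _).trans_le hδ⟩

theorem qhDist_eq_zero_of_compl_eq_empty {Ω : Set ℂ} (h : Ωᶜ = ∅) (x y : ℂ) :
    qhDist Ω x y = 0 := by
  have hsub : { L | ∃ γ : ℝ → ℂ, ContDiffOn ℝ 1 γ (Icc 0 1) ∧ γ 0 = x ∧ γ 1 = y ∧
      (∀ t ∈ Icc (0:ℝ) 1, γ t ∈ Ω) ∧ L = curveLen (qhDensity Ω) γ } ⊆ {0} := by
    rintro _ ⟨γ, -, -, -, -, rfl⟩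
    simp [curveLen, qhDensity, h]
  rw [qhDist, densityDist]
  obtain he | he := subset_singleton_iff_eq.1 hsub <;> rw [he]
  exacts [Real.sInf_empty, csInf_singleton 0]

/-- Proposition 3.5: a Denjoy domain whose real part has finitely many components is Gromov
`δ`-hyperbolic (for the Poincaré and quasihyperbolic metrics), with `δ` depending only on the
number `N` of components and on a bound `c₀` for the distances between consecutive (in index)
components. -/
theorem denjoy_finitely_many_components_hyperbolic :
    ∃ F : ℕ → ℝ → ℝ,
      ∀ (Ω : Set ℂ) (N : ℕ) (I : ℕ → Set ℝ) (d : ℂ → ℂ → ℝ),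
        IsDenjoyDomain Ω → 1 ≤ N →
        (∀ n, n < N → (I n).Nonempty ∧ IsOpen (I n) ∧ (I n).OrdConnected) →
        (∀ m n, m < N → n < N → m ≠ n → Disjoint (I m) (I n)) →
        (fun x : ℝ => (x : ℂ)) ⁻¹' Ω = (⋃ n < N, I n) →
        (d = qhDist Ω ∨ ∃ lam : ℂ → ℝ, IsPoincareDensity Ω lam ∧ d = densityDist Ω lam) →
        ∀ c₀ : ℝ,
          (∀ n, n + 1 < N →
            setDistFor d {z : ℂ | z.im = 0 ∧ z.re ∈ I n} {z : ℂ | z.im = 0 ∧ z.re ∈ I (n + 1)}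
              ≤ c₀) →
          GromovHyperbolicWith Ω d (F N c₀) := by
  refine ⟨fun N c₀ => 2 * (4 * (406 + 2 * projConst 37 406 (|c₀| + 1) (N - 1) + 2)), ?_⟩
  intro Ω N I d hΩ hN hI _ hIΩ hd c₀ hc₀
  have hmem : ∀ n < N, ∀ t ∈ I n, (t : ℂ) ∈ Ω := fun n hn t ht => by
    have : t ∈ (fun x : ℝ => (x : ℂ)) ⁻¹' Ω := hIΩ ▸ mem_iUnion₂.2 ⟨n, hn, ht⟩
    exact this
  obtain ⟨t, ht⟩ := (hI 0 hN).1
  have hS := hΩ.isSlitPlane (hmem 0 hN t ht)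
  obtain rfl | ⟨lam, ⟨p, h1, h2, h3, h4⟩, rfl⟩ := hd
  · obtain hne | hne := Ωᶜ.eq_empty_or_nonempty
    · refine gromovHyperbolicWith_of_eq_zero (qhDist_eq_zero_of_compl_eq_empty hne) ?_
      have := le_projConst (C := 37) (δ := 406) (by norm_num) (by norm_num)
        (by positivity : 0 ≤ |c₀| + 1) (N - 1)
      linarith
    · refine (hS.isSymmDensityOn_qhDensity hne).gromovHyperbolicWith (by norm_num)
        (hS.fourPointOn_qhDist hne) hN hI hIΩ ?_ hc₀
      intro n hn p hp q _ a ha hpq hqa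
      exact hS.qhDist_add_le_of_interval hne hpq hqa fun t ht =>
        hmem n hn t ((hI n hn).2.2.out hp ha ht)
  · have h : IsPoincareCover Ω lam p := ⟨h1, h2, h3, h4⟩
    refine (h.isSymmDensityOn hS).gromovHyperbolicWith (by norm_num)
      ((h.fourPointOn hS).mono (by norm_num)) hN hI hIΩ ?_ hc₀
    intro n hn u hu q hq a ha huq hqa
    rw [h.densityDist_add_of_interval hS (hI n hn).2.1 (hI n hn).2.2 (hmem n hn) hu hq ha huq hqa]
    norm_num

end
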